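/- (Proposition 5.1) Assume the hypotheses of Theorem 1.18: 𝔽_q has characteristic p; f ∈ 𝔽_q[x_1,…,x_n] has degree δ, with highest homogeneous part f^{(δ)} and second-highest homogeneous part f^{(δ')}, 1 ≤ δ' ≤ δ-1; f^{(δ)} = f_1^{a_1} ⋯ f_r^{a_r} with each f_i homogeneous; for every nonempty subset {i_1,…,i_k} ⊆ {1,…,r} the system f_{i_1} = ⋯ = f_{i_k} = 0 defines a smooth complete intersection of codimension k in P^{n-1}, and if k ≥ 2, or k = 1 and a_{i_1} > 1, the system f^{(δ')} = f_{i_1} = ⋯ = f_{i_k} = 0 defines a smooth complete intersection of codimension k+1 in P^{n-1}; and p ∤ δ δ' a_1 ⋯ a_r. Let k < n and let ω ∈ Ω^k be a homogeneous k-form with df^{(δ)} ∧ ω = 0 such that df^{(δ')} ∧ ω = df^{(δ)} ∧ ξ for some homogeneous k-form ξ. Then there exist homogeneous (k-1)-forms η_1, η_2 with df^{(δ)} ∧ η_1 = 0 and ω = df^{(δ')} ∧ η_1 + df^{(δ)} ∧ η_2. -/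

import Mathlib

set_option synthInstance.maxHeartbeats 1000000
set_option maxHeartbeats 1000000
open MvPolynomial

/-- The polynomial ring `𝔽_q[x_1,…,x_n]`. -/
abbrev PolyRing (F : Type) [Field F] (n : ℕ) : Type := MvPolynomial (Fin n) F

/-- The exterior algebra over `R = F[x_1,…,x_n]` of the free module on `dx_1,…,dx_n`;
the module of differential `k`-forms `Ω^k` is its degree-`k` part. -/
abbrev FormAlgebra (F : Type) [Field F] (n : ℕ) : Type :=
  ExteriorAlgebra (PolyRing F n) (Fin n → PolyRing F n)

/-- `dg = Σ_i (∂g/∂x_i) dx_i` as an element of the exterior algebra. -/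
noncomputable def dform {F : Type} [Field F] {n : ℕ} (g : PolyRing F n) : FormAlgebra F n :=
  ExteriorAlgebra.ι (PolyRing F n) (fun j => MvPolynomial.pderiv j g)

/-- `c · dx_{s 0} ∧ ⋯ ∧ dx_{s (k-1)}`. -/
noncomputable def wedgeMonomial {F : Type} [Field F] {n : ℕ} (k : ℕ) (s : Fin k → Fin n)
    (c : PolyRing F n) : FormAlgebra F n :=
  c • (List.ofFn fun i => ExteriorAlgebra.ι (PolyRing F n)
        (Pi.single (s i) (1 : PolyRing F n))).prod

/-- `ω` is a differential `k`-form, i.e. an `R`-linear combination of `k`-fold wedge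
products of the `dx_i`. -/
def IsForm {F : Type} [Field F] {n : ℕ} (k : ℕ) (ω : FormAlgebra F n) : Prop :=
  ω ∈ AddSubgroup.closure {x | ∃ (s : Fin k → Fin n) (c : PolyRing F n), x = wedgeMonomial k s c}

/-- `ω` is a homogeneous `k`-form whose coefficients are homogeneous polynomials of degree `d`. -/
def IsHomogeneousForm {F : Type} [Field F] {n : ℕ} (k d : ℕ) (ω : FormAlgebra F n) : Prop :=
  ω ∈ AddSubgroup.closure {x | ∃ (s : Fin k → Fin n) (c : PolyRing F n),
    c.IsHomogeneous d ∧ x = wedgeMonomial k s c}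

/-- The system of homogeneous equations `g i = 0` defines a smooth complete intersection
in `P^{n-1}`: over an algebraic closure, the only common zero of the `g i` in affine
`n`-space at which the differentials `d(g i)` are linearly dependent is the origin. -/
def IsSmoothCI {F : Type} [Field F] {n : ℕ} {ι : Type} (g : ι → PolyRing F n) : Prop :=
  ∀ x : Fin n → AlgebraicClosure F,
    (∀ i, MvPolynomial.eval x
      (MvPolynomial.map (algebraMap F (AlgebraicClosure F)) (g i)) = 0) →
    ¬ LinearIndependent (AlgebraicClosure F)
      (fun i => fun j : Fin n => MvPolynomial.eval x
        (MvPolynomial.map (algebraMap F (AlgebraicClosure F)) (MvPolynomial.pderiv j (g i)))) →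
    x = 0

/-- `df_{i_1} ∧ ⋯ ∧ df_{i_l}` for the increasing enumeration `i_1 < ⋯ < i_l` of `s`. -/
noncomputable def dWedge {F : Type} [Field F] {n : ℕ} {r : ℕ} (g : Fin r → PolyRing F n)
    (s : Finset (Fin r)) : FormAlgebra F n :=
  ((s.sort (· ≤ ·)).map fun i => dform (g i)).prod

/-- The polynomial form `(Σ_i a_i (∏_j f_j^{expo j}) df_i/f_i) ∧ Ω_{i_1⋯i_l}`, where
`Ω_{i_1⋯i_l} = (df_{i_1}/f_{i_1}) ∧ ⋯ ∧ (df_{i_l}/f_{i_l})` and `s = {i_1 < ⋯ < i_l}`;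
all denominators cancel provided `expo j ≥ 1` for all `j`. -/
noncomputable def clearedThetaOmega {F : Type} [Field F] {n : ℕ} {r : ℕ}
    (g : Fin r → PolyRing F n) (a : Fin r → ℕ) (expo : Fin r → ℕ) (s : Finset (Fin r)) :
    FormAlgebra F n :=
  ∑ i ∈ sᶜ, ((a i : PolyRing F n) *
      ∏ j, g j ^ (expo j - (if j ∈ insert i s then 1 else 0))) • (dform (g i) * dWedge g s)

section Depth

open CategoryTheory Abelian

variable {R : Type} [CommRing R]

/-- The `I`-depth of `M` is at least `d`, expressed through the vanishing of
`Ext^i(N, M)` for `i < d` and all finite modules `N` supported on `V(I)`. -/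
def DepthGE (I : Ideal R) (d : ℕ) (M : Type) [AddCommGroup M] [Module R M] : Prop :=
  ∀ N : ModuleCat.{0} R, Module.Finite R N → Module.support R N ⊆ PrimeSpectrum.zeroLocus I →
    ∀ i < d, Subsingleton (Ext N (ModuleCat.of R M) i)

namespace DepthGE

variable {I : Ideal R} {d : ℕ} {A B C : Type} [AddCommGroup A] [Module R A]
  [AddCommGroup B] [Module R B] [AddCommGroup C] [Module R C]

theorem mono {e : ℕ} (h : DepthGE I d A) (hed : e ≤ d) : DepthGE I e A :=
  fun N hN hs i hi => h N hN hs i (hi.trans_le hed)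

theorem of_subsingleton [Subsingleton A] : DepthGE I d A := fun N _ _ i _ =>
  subsingleton_of_forall_eq 0 fun x => by
    have h : 𝟙 (ModuleCat.of R A) = 0 :=
      (ModuleCat.isZero_of_subsingleton (ModuleCat.of R A)).eq_of_src _ _
    rw [← x.comp_mk₀_id, h, Ext.mk₀_zero, Ext.comp_zero]

theorem shortExact {f : A →ₗ[R] B} {g : B →ₗ[R] C} (hf : Function.Injective f)
    (hg : Function.Surjective g) (h : Function.Exact f g) :
    (ModuleCat.shortComplexOfCompEqZero f g h.linearMap_comp_eq_zero).ShortExact where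
  exact := (ShortComplex.ShortExact.moduleCat_exact_iff_function_exact _).2 h
  mono_f := (ModuleCat.mono_iff_injective _).2 hf
  epi_g := (ModuleCat.epi_iff_surjective _).2 hg

theorem of_exact_right {f : A →ₗ[R] B} {g : B →ₗ[R] C} (hf : Function.Injective f)
    (hg : Function.Surjective g) (h : Function.Exact f g)
    (hA : DepthGE I (d + 1) A) (hB : DepthGE I d B) : DepthGE I d C := by
  intro N hN hs i hi
  have hS := shortExact hf hg h
  refine subsingleton_of_forall_eq 0 fun x => ?_
  have := hA N hN hs (i + 1) (by omega)
  obtain ⟨y, rfl⟩ := Ext.covariant_sequence_exact₃ (hS := hS) N x rfl (Subsingleton.elim _ _)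
  have := hB N hN hs i hi
  rw [show y = 0 from Subsingleton.elim _ _]
  simp

theorem of_exact_middle {f : A →ₗ[R] B} {g : B →ₗ[R] C} (hf : Function.Injective f)
    (hg : Function.Surjective g) (h : Function.Exact f g)
    (hA : DepthGE I d A) (hC : DepthGE I d C) : DepthGE I d B := by
  intro N hN hs i hi
  have hS := shortExact hf hg h
  refine subsingleton_of_forall_eq 0 fun x => ?_
  have := hC N hN hs i hi
  obtain ⟨y, rfl⟩ := Ext.covariant_sequence_exact₂ (hS := hS) N x (Subsingleton.elim _ _)
  have := hA N hN hs i hi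
  rw [show y = 0 from Subsingleton.elim _ _]
  simp

theorem of_equiv (e : A ≃ₗ[R] B) (h : DepthGE I d A) : DepthGE I d B :=
  of_exact_middle (g := (0 : B →ₗ[R] PUnit)) (f := e.toLinearMap) e.injective
    (fun x => ⟨0, rfl⟩) (fun x => by simp) h of_subsingleton

theorem pi (h : DepthGE I d A) (m : ℕ) : DepthGE I d (Fin m → A) := by
  induction m with
  | zero => exact of_subsingleton
  | succ m ih =>
    refine of_exact_middle (f := LinearMap.single R (fun _ => A) (0 : Fin (m + 1)))
      (g := LinearMap.funLeft R A Fin.succ) (Pi.single_injective (M := fun _ => A) (0 : Fin (m + 1))) ?_ ?_ h ih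
    · exact LinearMap.funLeft_surjective_of_injective _ _ _ (Fin.succ_injective m)
    · intro x
      constructor
      · intro hx
        refine ⟨x 0, ?_⟩
        ext i
        refine Fin.cases ?_ (fun j => ?_) i
        · simp
        · simpa using (congrFun hx j).symm
      · rintro ⟨y, rfl⟩
        ext j
        simp [LinearMap.funLeft_apply]

theorem of_free [Module.Free R A] [Module.Finite R A] (h : DepthGE I d R) : DepthGE I d A :=
  (h.pi _).of_equiv ((LinearEquiv.funCongrLeft R R (Fintype.equivFin _)).trans
    (Module.Free.chooseBasis R A).equivFun.symm)

theorem eq_zero (h : DepthGE I d A) (hd : 0 < d) {v : A}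
    (hv : I ≤ (Ideal.torsionOf R A v).radical) : v = 0 := by
  let N := ModuleCat.of R (R ⧸ Ideal.torsionOf R A v)
  have hs : Module.support R N ⊆ PrimeSpectrum.zeroLocus I := by
    rw [Module.support_eq_zeroLocus]
    simp only [N]
    rw [Ideal.annihilator_quotient, PrimeSpectrum.zeroLocus_subset_zeroLocus_iff]
    exact hv
  have h0 := h N (by simp only [N]; infer_instance) hs 0 hd
  have h1 : Subsingleton (N →ₗ[R] A) :=
    ((Ext.addEquiv₀ (X := N) (Y := ModuleCat.of R A)).trans
      ModuleCat.homAddEquiv).symm.injective.subsingleton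
  let φ : (R ⧸ Ideal.torsionOf R A v) →ₗ[R] A :=
    Submodule.liftQ _ (LinearMap.toSpanSingleton R A v) le_rfl
  have h2 : φ = 0 := h1.elim _ _
  have h3 : φ (Submodule.Quotient.mk 1) = v := 
    (Submodule.liftQ_apply _ _ _).trans (one_smul R v)
  rw [← h3, h2, LinearMap.zero_apply]

end DepthGE

variable {M M' : Type} [AddCommGroup M] [Module R M] [AddCommGroup M'] [Module R M']

/-- The subquotient `B / A` has `I`-depth at least `d`. -/
def SubquotientDepthGE (I : Ideal R) (d : ℕ) (A B : Submodule R M) : Prop :=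
  DepthGE I d (B ⧸ A.submoduleOf B)

namespace SubquotientDepthGE

variable {I : Ideal R} {d : ℕ} {A B : Submodule R M} {A' B' : Submodule R M'}

theorem mono {e : ℕ} (h : SubquotientDepthGE I d A B) (hed : e ≤ d) :
    SubquotientDepthGE I e A B :=
  DepthGE.mono h hed

theorem of_le (h : B ≤ A) : SubquotientDepthGE I d A B := by
  have : Subsingleton (B ⧸ A.submoduleOf B) :=
    Submodule.Quotient.subsingleton_iff.2 (Submodule.submoduleOf_eq_top.2 h)
  exact DepthGE.of_subsingleton

theorem bot (h : DepthGE I d B) : SubquotientDepthGE I d ⊥ B := by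
  refine h.of_equiv (Submodule.quotEquivOfEqBot _ ?_).symm
  ext x; simp [Submodule.submoduleOf]

theorem of_map (h : SubquotientDepthGE I (d + 1) A B) (h' : SubquotientDepthGE I d A' B')
    (f : M →ₗ[R] M') (hB : ∀ b ∈ B, f b ∈ B') (hA : ∀ b ∈ A, f b ∈ A')
    (hAB : ∀ b ∈ B, f b ∈ A' → b ∈ A) :
    SubquotientDepthGE I d (A' ⊔ B.map f) B' := by
  let f' : B →ₗ[R] B' := f.restrict hB
  have hf' : A.submoduleOf B ≤ (A'.submoduleOf B').comap f' := fun x hx => hA _ hx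
  have hg : A'.submoduleOf B' ≤ (A' ⊔ B.map f).submoduleOf B' :=
    fun x hx => Submodule.mem_sup_left (S := A') hx
  refine DepthGE.of_exact_right (f := Submodule.mapQ _ _ f' hf')
    (g := Submodule.factor hg) ?_ (Submodule.factor_surjective hg) ?_ h h'
  · rw [← LinearMap.ker_eq_bot, LinearMap.ker_eq_bot']
    intro x
    obtain ⟨x, rfl⟩ := Submodule.Quotient.mk_surjective _ x
    intro hx
    rw [Submodule.mapQ_apply, Submodule.Quotient.mk_eq_zero] at hx
    rw [Submodule.Quotient.mk_eq_zero]
    exact hAB _ x.2 hx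
  · intro y
    obtain ⟨y, rfl⟩ := Submodule.Quotient.mk_surjective _ y
    constructor
    · intro hy
      have hy : (y : M') ∈ A' ⊔ B.map f := 
        (Submodule.Quotient.mk_eq_zero ((A' ⊔ B.map f).submoduleOf B')).1 hy
      obtain ⟨a, ha, _, ⟨b, hb, rfl⟩, hab⟩ := Submodule.mem_sup.1 hy
      refine ⟨Submodule.Quotient.mk ⟨b, hb⟩, ?_⟩
      rw [Submodule.mapQ_apply, Submodule.Quotient.eq]
      change f b - y ∈ A'
      rw [← hab]
      simpa using A'.neg_mem ha
    · rintro ⟨x, hx⟩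
      obtain ⟨x, rfl⟩ := Submodule.Quotient.mk_surjective _ x
      rw [← hx, Submodule.mapQ_apply]
      change Submodule.Quotient.mk _ = _
      rw [Submodule.Quotient.mk_eq_zero]
      exact (Submodule.mem_sup_right ⟨x, x.2, rfl⟩ : f x ∈ A' ⊔ B.map f)

theorem map (h : SubquotientDepthGE I d A B) (f : M →ₗ[R] M')
    (hA : ∀ b ∈ B, f b = 0 ↔ b ∈ A) : SubquotientDepthGE I d ⊥ (B.map f) := by
  let f' : B →ₗ[R] B.map f := f.submoduleMap B
  have hk : LinearMap.ker f' = A.submoduleOf B := by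
    ext x
    rw [LinearMap.mem_ker, Submodule.submoduleOf, Submodule.mem_comap, Submodule.subtype_apply, ← hA _ x.2, ← Submodule.coe_eq_zero]
    rfl
  refine bot (DepthGE.of_equiv ?_ h)
  exact (Submodule.quotEquivOfEq _ _ hk.symm).trans
    (f'.quotKerEquivOfSurjective (f.submoduleMap_surjective B))

theorem mem (h : SubquotientDepthGE I d A B) (hd : 0 < d) {v : M} (hv : v ∈ B) {J : Ideal R}
    (hIJ : I ≤ J.radical) (hJ : ∀ a ∈ J, a • v ∈ A) : v ∈ A := by
  have h1 : (Submodule.Quotient.mk ⟨v, hv⟩ : B ⧸ A.submoduleOf B) = 0 := by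
    refine DepthGE.eq_zero h hd (hIJ.trans (Ideal.radical_mono fun a ha => ?_))
    rw [Ideal.mem_torsionOf_iff, ← Submodule.Quotient.mk_smul, Submodule.Quotient.mk_eq_zero]
    exact hJ a ha
  exact (Submodule.Quotient.mk_eq_zero (A.submoduleOf B)).1 h1

end SubquotientDepthGE

/-- The polynomial ring has depth `n` with respect to the irrelevant ideal. -/
theorem MvPolynomial.depthGE (K : Type) [Field K] (n : ℕ) :
    DepthGE (Ideal.span (Set.range (X : Fin n → MvPolynomial (Fin n) K))) n (MvPolynomial (Fin n) K) := by
  intro N hN hs i hi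
  have hm : ∀ f ∈ Ideal.span (Set.range (X : Fin n → MvPolynomial (Fin n) K)),
      constantCoeff f = 0 := by
    intro f hf
    rw [← Set.image_univ, mem_ideal_span_X_image] at hf
    by_contra h
    obtain ⟨i, -, hi⟩ := hf 0 (by rwa [mem_support_iff])
    exact hi rfl
  have hlt : (Ideal.span (Set.range (X : Fin n → MvPolynomial (Fin n) K))) •
      (⊤ : Submodule (MvPolynomial (Fin n) K) (MvPolynomial (Fin n) K)) < ⊤ := by
    rw [smul_eq_mul, Ideal.mul_top, lt_top_iff_ne_top, Ideal.ne_top_iff_one]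
    intro h
    simpa using hm 1 h
  have hmem : ∀ f ∈ List.ofFn (X : Fin n → MvPolynomial (Fin n) K),
      f ∈ Ideal.span (Set.range (X : Fin n → MvPolynomial (Fin n) K)) := by
    intro f hf
    rw [List.mem_ofFn'] at hf
    exact Ideal.subset_span hf
  refine ModuleCat.subsingleton_ext_of_exists_isRegular _ N hs (ModuleCat.of _ _) hlt
    (List.ofFn X) hmem ⟨?_, ?_⟩ i (by simpa using hi)
  · rw [RingTheory.Sequence.isWeaklyRegular_iff_Fin]
    intro j
    have htake : Ideal.ofList ((List.ofFn (X : Fin n → MvPolynomial (Fin n) K)).take j) =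
        Ideal.span (X '' {l : Fin n | (l : ℕ) < j}) := by
      rw [Ideal.ofList]
      congr 1
      ext f
      simp only [Set.mem_ofPred_eq, List.mem_take_iff_getElem, Set.mem_image]
      constructor
      · rintro ⟨l, hl, rfl⟩
        exact ⟨⟨l, by simpa using hl.trans_le (min_le_right _ _)⟩, by simp at hl ⊢; omega, by simp⟩
      · rintro ⟨l, hl, rfl⟩
        exact ⟨l, by simpa using hl, by simp⟩
    rw [isSMulRegular_quotient_iff_mem_of_smul_mem]
    intro f hf
    simp only [smul_eq_mul, Ideal.mul_top, htake] at hf ⊢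
    rw [mem_ideal_span_X_image] at hf ⊢
    intro s hs
    obtain ⟨l, hl, hl'⟩ := hf (Finsupp.single ⟨j, by simpa using j.2⟩ 1 + s) (by
      rw [mem_support_iff] at hs ⊢
      simpa [coeff_X_mul] using hs)
    refine ⟨l, hl, ?_⟩
    rwa [Finsupp.add_apply, Finsupp.single_eq_of_ne, zero_add] at hl'
    intro h
    subst h
    simp at hl
  · intro h
    refine hlt.not_ge (h.le.trans (Submodule.smul_mono_left ?_))
    exact Ideal.span_le.2 hmem

end Depth

section Saito

open ExteriorAlgebra

variable {R : Type} [CommRing R] {L : Type} [AddCommGroup L] [Module R L]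

/-- Contraction of an exterior form with a linear form. -/
noncomputable def interiorProd (D : Module.Dual R L) : ExteriorAlgebra R L →ₗ[R] ExteriorAlgebra R L :=
  CliffordAlgebra.contractLeft (Q := (0 : QuadraticForm R L)) D

theorem interiorProd_ι_mul (D : Module.Dual R L) (v : L) (u : ExteriorAlgebra R L) :
    interiorProd D (ι R v * u) = D v • u - ι R v * interiorProd D u :=
  CliffordAlgebra.contractLeft_ι_mul _ _ _

theorem interiorProd_algebraMap (D : Module.Dual R L) (x : R) :
    interiorProd D (algebraMap R _ x) = 0 :=
  CliffordAlgebra.contractLeft_algebraMap _ _ _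

theorem interiorProd_one (D : Module.Dual R L) : interiorProd D (1 : ExteriorAlgebra R L) = 0 :=
  CliffordAlgebra.contractLeft_one _ _

theorem ι_mul_ι_mul_self (v : L) (u : ExteriorAlgebra R L) : ι R v * (ι R v * u) = 0 := by
  rw [← mul_assoc, ι_sq_zero, zero_mul]

theorem ι_mul_ι_mul_swap (v w : L) (u : ExteriorAlgebra R L) :
    ι R v * (ι R w * u) = -(ι R w * (ι R v * u)) := by
  rw [eq_neg_iff_add_eq_zero, ← mul_assoc, ← mul_assoc, ← add_mul, ι_add_mul_swap, zero_mul]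

theorem ι_mul_mem {j : ℕ} (v : L) {u : ExteriorAlgebra R L} (hu : u ∈ ⋀[R]^j L) :
    ι R v * u ∈ ⋀[R]^(j + 1) L := by
  rw [exteriorPower, pow_succ']
  exact Submodule.mul_mem_mul ⟨v, rfl⟩ hu

theorem interiorProd_eq_zero (D : Module.Dual R L) {u : ExteriorAlgebra R L}
    (hu : u ∈ ⋀[R]^0 L) : interiorProd D u = 0 := by
  rw [exteriorPower, pow_zero] at hu
  obtain ⟨x, rfl⟩ := Submodule.mem_one.1 hu
  exact interiorProd_algebraMap D x

theorem interiorProd_mem {j : ℕ} (D : Module.Dual R L) {u : ExteriorAlgebra R L}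
    (hu : u ∈ ⋀[R]^(j + 1) L) : interiorProd D u ∈ ⋀[R]^j L := by
  induction j generalizing u with
  | zero =>
    rw [exteriorPower, zero_add, pow_one] at hu
    obtain ⟨v, rfl⟩ := hu
    rw [← mul_one (ι R v), interiorProd_ι_mul, interiorProd_one, mul_zero, sub_zero, exteriorPower,
      pow_zero]
    exact Submodule.smul_mem _ _ (Submodule.one_le.1 le_rfl)
  | succ j ih =>
    rw [exteriorPower, pow_succ'] at hu
    induction hu using Submodule.mul_induction_on' with
    | mem_mul_mem v hv u hu =>
      obtain ⟨v, rfl⟩ := hv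
      rw [interiorProd_ι_mul]
      exact Submodule.sub_mem _ (Submodule.smul_mem _ _ hu) (ι_mul_mem v (ih hu))
    | add x _ y _ hx hy =>
      rw [map_add]
      exact Submodule.add_mem _ hx hy

/-- The degree `j` part of the ideal generated by the sections in the list `l`. -/
def wedgeIdeal : List L → ℕ → Submodule R (ExteriorAlgebra R L)
  | [], _ => ⊥
  | _ :: _, 0 => ⊥
  | v :: l, j + 1 => wedgeIdeal l (j + 1) ⊔ (⋀[R]^j L).map (LinearMap.mulLeft R (ι R v))

theorem wedgeIdeal_zero (l : List L) : wedgeIdeal (R := R) l 0 = ⊥ := by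
  cases l <;> rfl

theorem wedgeIdeal_le (l : List L) (j : ℕ) : wedgeIdeal l j ≤ ⋀[R]^j L := by
  induction l with
  | nil => exact bot_le
  | cons v l ih =>
    cases j with
    | zero => exact bot_le
    | succ j =>
      refine sup_le ih ?_
      rintro _ ⟨u, hu, rfl⟩
      exact ι_mul_mem v hu

theorem wedgeIdeal_le_cons (v : L) (l : List L) (j : ℕ) :
    wedgeIdeal (R := R) l j ≤ wedgeIdeal (v :: l) j := by
  cases j with
  | zero => rw [wedgeIdeal_zero, wedgeIdeal_zero]
  | succ j => exact le_sup_left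

theorem ι_mul_mem_wedgeIdeal_of_mem {l : List L} {v : L} (hv : v ∈ l) {j : ℕ}
    {u : ExteriorAlgebra R L} (hu : u ∈ ⋀[R]^j L) : ι R v * u ∈ wedgeIdeal l (j + 1) := by
  induction l with
  | nil => simp at hv
  | cons w l ih =>
    rcases List.mem_cons.1 hv with rfl | hv
    · exact Submodule.mem_sup_right ⟨u, hu, rfl⟩
    · exact Submodule.mem_sup_left (ih hv)

theorem ι_mul_mem_wedgeIdeal (v : L) (l : List L) {j : ℕ} {u : ExteriorAlgebra R L}
    (hu : u ∈ wedgeIdeal l j) : ι R v * u ∈ wedgeIdeal l (j + 1) := by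
  induction l generalizing u with
  | nil => rw [(Submodule.mem_bot R).1 hu, mul_zero]; exact Submodule.zero_mem _
  | cons w l ih =>
    cases j with
    | zero => rw [(Submodule.mem_bot R).1 hu, mul_zero]; exact Submodule.zero_mem _
    | succ j =>
      obtain ⟨x, hx, _, ⟨y, hy, rfl⟩, rfl⟩ := Submodule.mem_sup.1 hu
      rw [mul_add]
      refine Submodule.add_mem _ (Submodule.mem_sup_left (ih hx)) ?_
      rw [LinearMap.mulLeft_apply, ι_mul_ι_mul_swap]
      exact Submodule.neg_mem _ (Submodule.mem_sup_right ⟨_, ι_mul_mem v hy, rfl⟩)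

theorem ι_mul_mem_wedgeIdeal_cons (v : L) (l : List L) {j : ℕ} {u : ExteriorAlgebra R L}
    (hu : u ∈ wedgeIdeal (v :: l) j) : ι R v * u ∈ wedgeIdeal l (j + 1) := by
  cases j with
  | zero => rw [(Submodule.mem_bot R).1 hu, mul_zero]; exact Submodule.zero_mem _
  | succ j =>
    obtain ⟨x, hx, _, ⟨y, hy, rfl⟩, rfl⟩ := Submodule.mem_sup.1 hu
    rw [mul_add, LinearMap.mulLeft_apply, ι_mul_ι_mul_self, add_zero]
    exact ι_mul_mem_wedgeIdeal v l hx

theorem interiorProd_mem_wedgeIdeal {D : Module.Dual R L} {l : List L} (hD : ∀ v ∈ l, D v = 0)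
    {j : ℕ} {u : ExteriorAlgebra R L} (hu : u ∈ wedgeIdeal l (j + 1)) :
    interiorProd D u ∈ wedgeIdeal l j := by
  induction l generalizing u with
  | nil => rw [(Submodule.mem_bot R).1 hu, map_zero]; exact Submodule.zero_mem _
  | cons w l ih =>
    obtain ⟨x, hx, _, ⟨y, hy, rfl⟩, rfl⟩ := Submodule.mem_sup.1 hu
    rw [map_add, LinearMap.mulLeft_apply, interiorProd_ι_mul, hD w (by simp), zero_smul, zero_sub]
    refine Submodule.add_mem _ (wedgeIdeal_le_cons _ _ _
      (ih (fun v hv => hD v (List.mem_cons_of_mem _ hv)) hx)) (Submodule.neg_mem _ ?_)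
    cases j with
    | zero => rw [interiorProd_eq_zero D hy, mul_zero]; exact Submodule.zero_mem _
    | succ j => exact ι_mul_mem_wedgeIdeal_of_mem (by simp) (interiorProd_mem D hy)

theorem Prime.exists_eq_smul_of_smul_eq {M : Type} [AddCommGroup M] [Module R M]
    [Module.Free R M] [Module.Finite R M] {q x : R} (hq : Prime q) (hx : ¬ q ∣ x) {v w : M} (h : x • v = q • w) :
    ∃ u, v = q • u := by
  let b := Module.Free.chooseBasis R M
  have h1 : ∀ i, q ∣ b.repr v i := fun i => by
    have h2 := congrArg (fun y => b.repr y i) h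
    simp only [map_smul, Finsupp.smul_apply, smul_eq_mul] at h2
    exact (hq.dvd_or_dvd ⟨_, h2⟩).resolve_left hx
  choose c hc using h1
  refine ⟨b.equivFun.symm c, b.ext_elem fun i => ?_⟩
  rw [hc, map_smul, Finsupp.smul_apply, smul_eq_mul, ← b.equivFun_apply,
    LinearEquiv.apply_symm_apply]

/-- The values at `v` of the linear forms vanishing on the members of `l`. -/
def valueIdeal (R : Type) [CommRing R] {L : Type} [AddCommGroup L] [Module R L] (v : L)
    (l : List L) : Ideal R :=
  (Submodule.span R {u | u ∈ l}).dualAnnihilator.map (Module.Dual.eval R L v)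

theorem mem_valueIdeal {v : L} {l : List L} {x : R} :
    x ∈ valueIdeal R v l ↔ ∃ D : Module.Dual R L, (∀ u ∈ l, D u = 0) ∧ D v = x := by
  simp only [valueIdeal, Submodule.mem_map, Submodule.mem_dualAnnihilator]
  refine exists_congr fun D => and_congr ⟨fun h u hu => h u (Submodule.subset_span hu),
    fun h u hu => ?_⟩ Iff.rfl
  exact (Submodule.span_le (p := LinearMap.ker D)).2 h hu

/-- The sections in the list are linearly independent away from `V(I)`, in the sense that each of
them can be separated from the later ones by linear forms. -/
def IndependentOff (I : Ideal R) : List L → Prop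
  | [] => True
  | v :: l => I ≤ (valueIdeal R v l).radical ∧ IndependentOff I l

theorem ι_mul_prod_ι (l : List L) : ∃ ε : R, ε * ε = 1 ∧
    (∀ (v : L) (c : ExteriorAlgebra R L),
      ι R v * ((l.map (ι R)).prod * c) = ε • ((l.map (ι R)).prod * (ι R v * c))) ∧
    ∀ D : Module.Dual R L, (∀ v ∈ l, D v = 0) → ∀ c,
      interiorProd D ((l.map (ι R)).prod * c) = ε • ((l.map (ι R)).prod * interiorProd D c) := by
  induction l with
  | nil => exact ⟨1, by simp, by simp, by simp⟩
  | cons w l ih =>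
    obtain ⟨ε, h1, h2, h3⟩ := ih
    refine ⟨-ε, by simpa, fun v c => ?_, fun D hD c => ?_⟩
    · rw [List.map_cons, List.prod_cons, mul_assoc, ι_mul_ι_mul_swap, h2, mul_smul_comm, neg_smul,
        mul_assoc]
    · rw [List.map_cons, List.prod_cons, mul_assoc, interiorProd_ι_mul, hD w (by simp), zero_smul,
        zero_sub, h3 D (fun v hv => hD v (List.mem_cons_of_mem _ hv)), mul_smul_comm, neg_smul,
        mul_assoc]

theorem prod_ι_mul_mem (l : List L) {j : ℕ} {c : ExteriorAlgebra R L} (hc : c ∈ ⋀[R]^j L) :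
    (l.map (ι R)).prod * c ∈ ⋀[R]^(j + l.length) L := by
  induction l with
  | nil => simpa
  | cons v l ih =>
    rw [List.map_cons, List.prod_cons, mul_assoc]
    exact ι_mul_mem v ih

theorem prod_ι_mul_eq_zero {l : List L} {j : ℕ} {c : ExteriorAlgebra R L}
    (hc : c ∈ wedgeIdeal l j) : (l.map (ι R)).prod * c = 0 := by
  induction l generalizing c with
  | nil => rw [(Submodule.mem_bot R).1 hc, mul_zero]
  | cons v l ih =>
    cases j with
    | zero => rw [(Submodule.mem_bot R).1 hc, mul_zero]
    | succ j =>
      obtain ⟨x, hx, _, ⟨y, hy, rfl⟩, rfl⟩ := Submodule.mem_sup.1 hc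
      obtain ⟨ε, h1, h2, -⟩ := ι_mul_prod_ι (R := R) l
      have h4 := h2 v (ι R v * y)
      rw [ι_mul_ι_mul_self, mul_zero, smul_zero] at h4
      rw [List.map_cons, List.prod_cons, mul_assoc, mul_add, ih hx, zero_add, LinearMap.mulLeft_apply, h4]

variable {I : Ideal R} {n : ℕ}

theorem wedgeIdeal_depth [Module.Free R L] [Module.Finite R L] (hR : DepthGE I n R) (l : List L)
    (hl : IndependentOff I l) (j : ℕ) (hj : j ≤ n) :
    SubquotientDepthGE I (n - j) (wedgeIdeal l j) (⋀[R]^j L) := by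
  induction l generalizing j with
  | nil => exact (SubquotientDepthGE.bot hR.of_free).mono (Nat.sub_le _ _)
  | cons v l ih =>
    induction j with
    | zero =>
      rw [wedgeIdeal_zero]
      exact (SubquotientDepthGE.bot hR.of_free).mono (Nat.sub_le _ _)
    | succ j ihj =>
      have hd : n - (j + 1) + 1 = n - j := by omega
      refine SubquotientDepthGE.of_map (A := wedgeIdeal (v :: l) j) ?_ (ih hl.2 _ hj) _
        (fun b hb => ι_mul_mem v hb) (fun b hb => ι_mul_mem_wedgeIdeal_cons v l hb)
        (fun c hc hvc => ?_)
      · rw [hd]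
        exact ihj (by omega)
      · refine (ihj (by omega)).mem (by omega) hc hl.1 fun x hx => ?_
        obtain ⟨D, hD, rfl⟩ := mem_valueIdeal.1 hx
        have h := interiorProd_mem_wedgeIdeal hD hvc
        rw [LinearMap.mulLeft_apply, interiorProd_ι_mul] at h
        rw [← sub_add_cancel (D v • c) (ι R v * interiorProd D c)]
        refine Submodule.add_mem _ (wedgeIdeal_le_cons _ _ _ h) ?_
        cases j with
        | zero => rw [interiorProd_eq_zero D hc, mul_zero]; exact Submodule.zero_mem _
        | succ j => exact ι_mul_mem_wedgeIdeal_of_mem (by simp) (interiorProd_mem D hc)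

/-- Saito's division lemma modulo `q`, up to the powers of elements of `I`. -/
theorem exists_pow_smul_mem (l : List L) (hl : IndependentOff I l) (q : R) {j : ℕ}
    {c u : ExteriorAlgebra R L} (hc : c ∈ ⋀[R]^j L) (hu : u ∈ ⋀[R]^(j + l.length) L)
    (h : (l.map (ι R)).prod * c = q • u) {x : R} (hx : x ∈ I) :
    ∃ N : ℕ, x ^ N • c ∈ wedgeIdeal l j ⊔ (⋀[R]^j L).map (LinearMap.lsmul R _ q) := by
  induction l generalizing c u with
  | nil =>
    refine ⟨0, Submodule.mem_sup_right ⟨u, by simpa using hu, ?_⟩⟩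
    simpa using h.symm
  | cons v l ih =>
    obtain ⟨M, hM⟩ := hl.1 hx
    obtain ⟨D, hD, hDv⟩ := mem_valueIdeal.1 hM
    obtain ⟨ε, h1, h2, h3⟩ := ι_mul_prod_ι (R := R) l
    have hvc : ι R v * interiorProd D c ∈ wedgeIdeal (v :: l) j := by
      cases j with
      | zero => rw [interiorProd_eq_zero D hc, mul_zero]; exact Submodule.zero_mem _
      | succ j => exact ι_mul_mem_wedgeIdeal_of_mem (by simp) (interiorProd_mem D hc)
    have h4 : (l.map (ι R)).prod * (D v • c - ι R v * interiorProd D c) = q • interiorProd D u := by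
      rw [← map_smul, ← h, List.map_cons, List.prod_cons, mul_assoc, interiorProd_ι_mul, h3 D hD,
        mul_smul_comm ε, h2, smul_smul, h1, one_smul, mul_sub, mul_smul_comm]
    obtain ⟨N, hN⟩ := ih hl.2
      (Submodule.sub_mem _ (Submodule.smul_mem _ _ hc) (wedgeIdeal_le _ _ hvc))
      (interiorProd_mem D hu) h4
    refine ⟨N + M, ?_⟩
    rw [pow_add, mul_smul, ← hDv, ← sub_add_cancel (D v • c) (ι R v * interiorProd D c), smul_add]
    exact Submodule.add_mem _ (sup_le_sup_right (wedgeIdeal_le_cons v l j) _ hN)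
      (Submodule.mem_sup_left (Submodule.smul_mem _ _ hvc))

variable [Module.Free R L] [Module.Finite R L]

theorem mem_wedgeIdeal_of_prod_eq_zero (hR : DepthGE I n R) {l : List L} (hl : IndependentOff I l)
    {j : ℕ} (hj : j < n) {c : ExteriorAlgebra R L} (hc : c ∈ ⋀[R]^j L)
    (h : (l.map (ι R)).prod * c = 0) : c ∈ wedgeIdeal l j := by
  have key := wedgeIdeal_depth hR l hl j hj.le
  refine key.mem (J := (wedgeIdeal l j).colon {c}) (by omega) hc (fun x hx => ?_) (fun x hx => ?_)
  · obtain ⟨N, hN⟩ := exists_pow_smul_mem l hl 0 hc (Submodule.zero_mem _)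
      (h.trans (smul_zero 0).symm) hx
    refine ⟨N, Submodule.mem_colon_singleton.2 ?_⟩
    rcases Submodule.mem_sup.1 hN with ⟨y, hy, _, ⟨z, -, rfl⟩, hyz⟩
    rw [← hyz, map_zero, LinearMap.zero_apply, add_zero]
    exact hy
  · exact Submodule.mem_colon_singleton.1 hx

theorem mem_wedgeIdeal_of_smul_mem [IsDomain R] (hR : DepthGE I n R) {l : List L}
    (hl : IndependentOff I l) {j : ℕ} (hj : j < n) {c : ExteriorAlgebra R L} (hc : c ∈ ⋀[R]^j L)
    {x : R} (hx : x ≠ 0) (h : x • c ∈ wedgeIdeal l j) : c ∈ wedgeIdeal l j := by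
  refine mem_wedgeIdeal_of_prod_eq_zero hR hl hj hc ?_
  have h1 := prod_ι_mul_eq_zero h
  rw [mul_smul_comm] at h1
  have h2 : x • (⟨_, prod_ι_mul_mem l hc⟩ : ⋀[R]^(j + l.length) L) = 0 := Subtype.ext h1
  simpa using (smul_eq_zero.1 h2).resolve_left hx

theorem mem_wedgeIdeal_sup_of_smul_mem [IsDomain R] (hR : DepthGE I n R) {l : List L}
    (hl : IndependentOff I l) {j : ℕ} (hj : j + 1 < n) {c : ExteriorAlgebra R L}
    (hc : c ∈ ⋀[R]^j L) {q x : R} (hq : Prime q) (hx : ¬ q ∣ x)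
    (h : x • c ∈ wedgeIdeal l j ⊔ (⋀[R]^j L).map (LinearMap.lsmul R _ q)) :
    c ∈ wedgeIdeal l j ⊔ (⋀[R]^j L).map (LinearMap.lsmul R _ q) := by
  have h1 : SubquotientDepthGE I 1 (wedgeIdeal l j ⊔ (⋀[R]^j L).map (LinearMap.lsmul R _ q))
      (⋀[R]^j L) := by
    have key := wedgeIdeal_depth hR l hl j (by omega)
    refine SubquotientDepthGE.of_map (A := wedgeIdeal l j) (key.mono (by omega))
      (key.mono (by omega)) _ (fun b hb => Submodule.smul_mem _ _ hb)
      (fun b hb => Submodule.smul_mem _ _ hb) fun b hb hqb =>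
      mem_wedgeIdeal_of_smul_mem hR hl (by omega) hb hq.ne_zero hqb
  obtain ⟨y, hy, _, ⟨z, hz, rfl⟩, hyz⟩ := Submodule.mem_sup.1 h
  have h2 : x • ((l.map (ι R)).prod * c) = q • ((l.map (ι R)).prod * z) := by
    rw [← mul_smul_comm, ← hyz, mul_add, prod_ι_mul_eq_zero hy, zero_add, LinearMap.lsmul_apply,
      mul_smul_comm]
  obtain ⟨u, hu⟩ : ∃ u : ⋀[R]^(j + l.length) L, 
      (⟨_, prod_ι_mul_mem l hc⟩ : ⋀[R]^(j + l.length) L) = q • u := by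
    have h3 : x • (⟨_, prod_ι_mul_mem l hc⟩ : ⋀[R]^(j + l.length) L) =
        q • ⟨_, prod_ι_mul_mem l hz⟩ :=
      Subtype.ext h2
    exact hq.exists_eq_smul_of_smul_eq (M := ⋀[R]^(j + l.length) L) hx h3
  refine h1.mem (J := (wedgeIdeal l j ⊔ (⋀[R]^j L).map (LinearMap.lsmul R _ q)).colon {c})
    one_pos hc (fun x hx => ?_) (fun x hx => Submodule.mem_colon_singleton.1 hx)
  obtain ⟨N, hN⟩ := exists_pow_smul_mem l hl q hc u.2 (congrArg Subtype.val hu) hx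
  exact ⟨N, Submodule.mem_colon_singleton.2 hN⟩

end Saito

section LogForms

open ExteriorAlgebra

instance ExteriorAlgebra.free {R L : Type} [CommRing R] [AddCommGroup L] [Module R L]
    [Module.Free R L] : Module.Free R (ExteriorAlgebra R L) :=
  Module.Free.of_equiv (DirectSum.decomposeLinearEquiv fun i : ℕ => ⋀[R]^i L).symm

variable {R : Type} [CommRing R] {V : Type} [AddCommGroup V] [Module R V] {r : ℕ}

/-- The `i`-th coordinate on `V × R^r`. -/
def sndCoord (R V : Type) [CommRing R] [AddCommGroup V] [Module R V] {r : ℕ} (i : Fin r) :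
    Module.Dual R (V × (Fin r → R)) :=
  LinearMap.proj i ∘ₗ LinearMap.snd R V (Fin r → R)

/-- The section `g_i e_i - w_i` of `V × R^r`. -/
def graphSection (g : Fin r → R) (w : Fin r → V) (i : Fin r) : V × (Fin r → R) :=
  (-w i, Pi.single i (g i))

variable (g : Fin r → R) (w : Fin r → V)

theorem sndCoord_graphSection_of_ne {i j : Fin r} (h : i ≠ j) :
    sndCoord R V i (graphSection g w j) = 0 := by
  simp [sndCoord, graphSection, h]

theorem sndCoord_graphSection_self (i : Fin r) :
    sndCoord R V i (graphSection g w i) = g i := by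
  simp [sndCoord, graphSection]

theorem sndCoord_inl (i : Fin r) (v : V) : sndCoord R V i (LinearMap.inl R V _ v) = 0 := rfl

/-- Elimination of the `i`-th coordinate along the `i`-th section. -/
noncomputable def elim (i : Fin r) :
    ExteriorAlgebra R (V × (Fin r → R)) →ₗ[R] ExteriorAlgebra R (V × (Fin r → R)) :=
  interiorProd (sndCoord R V i) ∘ₗ LinearMap.mulLeft R (ι R (graphSection g w i))

theorem elim_apply (i : Fin r) (u : ExteriorAlgebra R (V × (Fin r → R))) :
    elim g w i u = g i • u -
      ι R (graphSection g w i) * interiorProd (sndCoord R V i) u := by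
  rw [elim, LinearMap.comp_apply, LinearMap.mulLeft_apply, interiorProd_ι_mul,
    sndCoord_graphSection_self]

theorem elim_graphSection_mul (i : Fin r) (u : ExteriorAlgebra R (V × (Fin r → R))) :
    elim g w i (ι R (graphSection g w i) * u) = 0 := by
  rw [elim, LinearMap.comp_apply, LinearMap.mulLeft_apply, ι_mul_ι_mul_self, map_zero]

theorem elim_ι_mul (i : Fin r) {v : V × (Fin r → R)} (hv : sndCoord R V i v = 0)
    (u : ExteriorAlgebra R (V × (Fin r → R))) :
    elim g w i (ι R v * u) = ι R v * elim g w i u := by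
  rw [elim_apply, elim_apply, interiorProd_ι_mul, hv, zero_smul, zero_sub, mul_neg,
    ι_mul_ι_mul_swap, mul_sub, mul_smul_comm, neg_neg]

theorem elim_mem (i : Fin r) {j : ℕ} {u : ExteriorAlgebra R (V × (Fin r → R))}
    (hu : u ∈ ⋀[R]^j (V × (Fin r → R))) : elim g w i u ∈ ⋀[R]^j (V × (Fin r → R)) :=
  interiorProd_mem _ (ι_mul_mem _ hu)

/-- Successive elimination of the coordinates in the list. -/
noncomputable def elimList : List (Fin r) →
    ExteriorAlgebra R (V × (Fin r → R)) →ₗ[R] ExteriorAlgebra R (V × (Fin r → R))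
  | [] => LinearMap.id
  | i :: l => elim g w i ∘ₗ elimList l

theorem elimList_mem (l : List (Fin r)) {j : ℕ} {u : ExteriorAlgebra R (V × (Fin r → R))}
    (hu : u ∈ ⋀[R]^j (V × (Fin r → R))) : elimList g w l u ∈ ⋀[R]^j (V × (Fin r → R)) := by
  induction l with
  | nil => exact hu
  | cons i l ih => exact elim_mem g w i ih

theorem elimList_ι_mul (l : List (Fin r)) {v : V × (Fin r → R)}
    (hv : ∀ i ∈ l, sndCoord R V i v = 0) (u : ExteriorAlgebra R (V × (Fin r → R))) :
    elimList g w l (ι R v * u) = ι R v * elimList g w l u := by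
  induction l with
  | nil => rfl
  | cons i l ih =>
    rw [elimList, LinearMap.comp_apply, ih fun i hi => hv i (List.mem_cons_of_mem _ hi),
      elim_ι_mul g w i (hv i (by simp)), LinearMap.comp_apply]

theorem elimList_graphSection_mul (l : List (Fin r)) {i : Fin r} (hi : i ∈ l)
    (u : ExteriorAlgebra R (V × (Fin r → R))) :
    elimList g w l (ι R (graphSection g w i) * u) = 0 := by
  induction l with
  | nil => simp at hi
  | cons k l ih =>
    rw [elimList, LinearMap.comp_apply]
    by_cases h : i ∈ l
    · rw [ih h, map_zero]
    · have hik : i = k := (List.mem_cons.1 hi).resolve_right h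
      subst hik
      have hne : ∀ j ∈ l, j ≠ i := fun j hj hji => h (hji ▸ hj)
      rw [elimList_ι_mul g w l fun j hj => sndCoord_graphSection_of_ne g w (hne j hj),
        elim_graphSection_mul]

theorem elimList_eq_zero (l l' : List (Fin r)) (hl : ∀ i ∈ l', i ∈ l) {j : ℕ}
    {u : ExteriorAlgebra R (V × (Fin r → R))}
    (hu : u ∈ wedgeIdeal (l'.map (graphSection g w)) j) : elimList g w l u = 0 := by
  induction l' generalizing u with
  | nil => rw [(Submodule.mem_bot R).1 hu, map_zero]
  | cons i l' ih =>
    cases j with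
    | zero => rw [(Submodule.mem_bot R).1 hu, map_zero]
    | succ j =>
      obtain ⟨x, hx, _, ⟨y, hy, rfl⟩, rfl⟩ := Submodule.mem_sup.1 hu
      rw [map_add, ih (fun k hk => hl k (List.mem_cons_of_mem _ hk)) hx, LinearMap.mulLeft_apply,
        elimList_graphSection_mul g w l (hl i (by simp)), zero_add]

theorem elimList_sub_mem (l : List (Fin r)) {j : ℕ} {u : ExteriorAlgebra R (V × (Fin r → R))}
    (hu : u ∈ ⋀[R]^j (V × (Fin r → R))) :
    elimList g w l u - (l.map g).prod • u ∈ wedgeIdeal (l.map (graphSection g w)) j := by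
  induction l with
  | nil =>
    simp only [elimList, LinearMap.id_apply, List.map_nil, List.prod_nil, one_smul, sub_self]
    exact Submodule.zero_mem _
  | cons i l ih =>
    rw [elimList, LinearMap.comp_apply, elim_apply, List.map_cons, List.map_cons, List.prod_cons,
      mul_smul, sub_right_comm, ← smul_sub]
    refine Submodule.sub_mem _ (Submodule.smul_mem _ _ (wedgeIdeal_le_cons _ _ _ ih)) ?_
    have h := elimList_mem g w l hu
    cases j with
    | zero => rw [interiorProd_eq_zero _ h, mul_zero]; exact Submodule.zero_mem _
    | succ j => exact ι_mul_mem_wedgeIdeal_of_mem (by simp) (interiorProd_mem _ h)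

/-- The map from exterior forms on `V × R^r` to exterior forms on `V` which multiplies by `∏ g_i`
and substitutes `w_i / g_i` for the basis vector `e_i`. -/
noncomputable def residueMap :
    ExteriorAlgebra R (V × (Fin r → R)) →ₗ[R] ExteriorAlgebra R V :=
  (ExteriorAlgebra.map (LinearMap.fst R V (Fin r → R))).toLinearMap ∘ₗ
    elimList g w (List.finRange r)

/-- The inclusion of the exterior forms on `V` in those on `V × R^r`. -/
noncomputable def extendForm (R V : Type) [CommRing R] [AddCommGroup V] [Module R V] (r : ℕ) :
    ExteriorAlgebra R V →ₐ[R] ExteriorAlgebra R (V × (Fin r → R)) :=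
  ExteriorAlgebra.map (LinearMap.inl R V (Fin r → R))

theorem extendForm_ι (v : V) : extendForm R V r (ι R v) = ι R (LinearMap.inl R V _ v) :=
  map_apply_ι _ _

theorem map_mem {L M : Type} [AddCommGroup L] [Module R L] [AddCommGroup M] [Module R M]
    (f : L →ₗ[R] M) {j : ℕ} {u : ExteriorAlgebra R L} (hu : u ∈ ⋀[R]^j L) :
    ExteriorAlgebra.map f u ∈ ⋀[R]^j M := by
  rw [← ιMulti_span_fixedDegree] at hu ⊢
  induction hu using Submodule.span_induction with
  | mem x hx =>
    obtain ⟨v, rfl⟩ := hx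
    rw [map_apply_ιMulti]
    exact Submodule.subset_span ⟨_, rfl⟩
  | zero => rw [map_zero]; exact Submodule.zero_mem _
  | add x y _ _ hx hy => rw [map_add]; exact Submodule.add_mem _ hx hy
  | smul a x _ hx => rw [map_smul]; exact Submodule.smul_mem _ _ hx

theorem residueMap_mem {j : ℕ} {u : ExteriorAlgebra R (V × (Fin r → R))}
    (hu : u ∈ ⋀[R]^j (V × (Fin r → R))) : residueMap g w u ∈ ⋀[R]^j V :=
  map_mem _ (elimList_mem g w _ hu)

theorem residueMap_graphSection_mul (i : Fin r) (u : ExteriorAlgebra R (V × (Fin r → R))) :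
    residueMap g w (ι R (graphSection g w i) * u) = 0 := by
  rw [residueMap, LinearMap.comp_apply, elimList_graphSection_mul g w _ (List.mem_finRange i),
    map_zero]

theorem residueMap_inl_mul (v : V) (u : ExteriorAlgebra R (V × (Fin r → R))) :
    residueMap g w (ι R (LinearMap.inl R V _ v) * u) = ι R v * residueMap g w u := by
  rw [residueMap, LinearMap.comp_apply, elimList_ι_mul g w _ fun i _ => sndCoord_inl i v]
  simp

theorem smul_single_eq (i : Fin r) :
    g i • ((0, Pi.single i 1) : V × (Fin r → R)) =
      graphSection g w i + LinearMap.inl R V _ (w i) := by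
  ext <;> simp [graphSection, Pi.single_apply]

theorem smul_residueMap_single_mul (i : Fin r) (u : ExteriorAlgebra R (V × (Fin r → R))) :
    g i • residueMap g w (ι R ((0, Pi.single i 1) : V × (Fin r → R)) * u) =
      ι R (w i) * residueMap g w u := by
  rw [← map_smul, ← smul_mul_assoc, ← map_smul, smul_single_eq g w, map_add, add_mul, map_add,
    residueMap_graphSection_mul, residueMap_inl_mul, zero_add]

theorem elimList_algebraMap (l : List (Fin r)) (x : R) :
    elimList g w l (algebraMap R _ x) = algebraMap R _ ((l.map g).prod * x) := by
  have h := elimList_sub_mem g w l (j := 0) (u := algebraMap R _ x) (by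
    rw [exteriorPower, pow_zero]
    exact Submodule.mem_one.2 ⟨x, rfl⟩)
  rw [wedgeIdeal_zero, Submodule.mem_bot, sub_eq_zero] at h
  rw [h, Algebra.smul_def, map_mul]

theorem residueMap_extendForm (z : ExteriorAlgebra R V) :
    residueMap g w (extendForm R V r z) = (∏ i, g i) • z := by
  induction z using CliffordAlgebra.left_induction with
  | algebraMap x =>
    rw [AlgHom.commutes, residueMap, LinearMap.comp_apply, elimList_algebraMap, AlgHom.toLinearMap_apply,
      AlgHom.commutes, Algebra.smul_def, ← map_mul, ← List.prod_ofFn, List.ofFn_eq_map]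
  | add x y hx hy => rw [map_add, map_add, hx, hy, smul_add]
  | ι_mul x m hx =>
    change residueMap g w (extendForm R V r (ι R m * x)) = _ • (ι R m * x)
    rw [map_mul, extendForm_ι, residueMap_inl_mul, hx, mul_smul_comm]

/-- The element `∑ a_i e_i` of `V × R^r`. -/
def weightVector (R V : Type) [CommRing R] [AddCommGroup V] [Module R V] {r : ℕ} (a : Fin r → ℕ) :
    V × (Fin r → R) :=
  (0, fun i => (a i : R))

/-- The list consisting of `∑ a_i e_i` and of the sections `g_i e_i - w_i`. -/
def logSections (a : Fin r → ℕ) : List (V × (Fin r → R)) :=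
  weightVector R V a :: (List.finRange r).map (graphSection g w)

/-- Wedge product with `∑ a_i e_i` followed by the residue map: its image consists of the forms
`(∏ g_i) (∑ a_i w_i / g_i) ∧ c`, for the logarithmic forms `c`. -/
noncomputable def logMap (a : Fin r → ℕ) :
    ExteriorAlgebra R (V × (Fin r → R)) →ₗ[R] ExteriorAlgebra R V :=
  residueMap g w ∘ₗ LinearMap.mulLeft R (ι R (weightVector R V a))

theorem logMap_apply (a : Fin r → ℕ) (u : ExteriorAlgebra R (V × (Fin r → R))) :
    logMap g w a u = residueMap g w (ι R (weightVector R V a) * u) := rfl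

/-- The kernel of wedge product with `v` in degree `k`. -/
noncomputable def wedgeKer {V : Type} [AddCommGroup V] [Module R V] (v : V) (k : ℕ) :
    Submodule R (ExteriorAlgebra R V) :=
  ⋀[R]^k V ⊓ LinearMap.ker (LinearMap.mulLeft R (ι R v))

theorem mem_wedgeKer {V : Type} [AddCommGroup V] [Module R V] {v : V} {k : ℕ}
    {z : ExteriorAlgebra R V} : z ∈ wedgeKer v k ↔ z ∈ ⋀[R]^k V ∧ ι R v * z = 0 := Iff.rfl

theorem extendForm_residueMap [IsDomain R] [Module.Free R V] (hg : ∀ i, g i ≠ 0)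
    (u : ExteriorAlgebra R (V × (Fin r → R))) :
    extendForm R V r (residueMap g w u) = elimList g w (List.finRange r) u := by
  induction u using CliffordAlgebra.left_induction with
  | algebraMap x =>
    rw [residueMap, LinearMap.comp_apply, elimList_algebraMap, AlgHom.toLinearMap_apply,
      AlgHom.commutes, AlgHom.commutes]
  | add x y hx hy => simp only [map_add, hx, hy]
  | ι_mul u v hu =>
    change extendForm R V r (residueMap g w (ι R v * u)) = elimList g w _ (ι R v * u)
    have hv : v = LinearMap.inl R V _ v.1 +
        ∑ i, v.2 i • ((0, Pi.single i 1) : V × (Fin r → R)) := by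
      ext j
      · simp [Prod.fst_sum]
      · simp [Prod.snd_sum, Finset.sum_apply, Pi.single_apply]
    have h1 : ∀ i, extendForm R V r (residueMap g w
        (ι R ((0, Pi.single i 1) : V × (Fin r → R)) * u)) =
        elimList g w (List.finRange r) (ι R ((0, Pi.single i 1) : V × (Fin r → R)) * u) := by
      intro i
      refine smul_right_injective _ (hg i) ?_
      simp only
      rw [← map_smul, smul_residueMap_single_mul, map_mul, extendForm_ι, hu, ← map_smul,
        ← smul_mul_assoc, ← map_smul, smul_single_eq g w, map_add, add_mul, map_add,
        elimList_graphSection_mul g w _ (List.mem_finRange i), zero_add,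
        elimList_ι_mul g w _ fun j _ => sndCoord_inl j _]
    rw [hv]
    simp only [map_add, map_sum, map_smul, add_mul, Finset.sum_mul, smul_mul_assoc, h1]
    rw [residueMap_inl_mul, map_mul, extendForm_ι, hu,
      elimList_ι_mul g w _ fun j _ => sndCoord_inl j _]

theorem logMap_eq_zero_of_mem (a : Fin r → ℕ) {k : ℕ}
    {c : ExteriorAlgebra R (V × (Fin r → R))} (hc : c ∈ wedgeIdeal (logSections g w a) k) :
    logMap g w a c = 0 := by
  rw [logMap_apply, residueMap, LinearMap.comp_apply,
    elimList_eq_zero g w _ _ (fun i hi => hi) (ι_mul_mem_wedgeIdeal_cons _ _ hc), map_zero]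

/-- The properties of a logarithmic differential `dF`, `F = ∏ g_i ^ a_i`, from which
the depth of the kernel of `dF ∧` is derived. -/
structure LogData (I : Ideal R) (n : ℕ) (g : Fin r → R) (w : Fin r → V) (a : Fin r → ℕ)
    (dF : V) : Prop where
  depth : DepthGE I n R
  indep : IndependentOff I (logSections g w a)
  ne_zero : ∀ i, g i ≠ 0
  pos : ∀ i, 0 < a i
  eq_sum : dF = ∑ i, ((a i : R) * (g i ^ (a i - 1) * ∏ j ∈ Finset.univ.erase i, g j ^ a j)) • w i
  leibniz : ∀ i, ∃ u : V,
    dF = ((a i : R) * (g i ^ (a i - 1) * ∏ j ∈ Finset.univ.erase i, g j ^ a j)) • w i +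
      g i ^ a i • u
  exists_not_dvd : ∀ p, Prime p → p ∣ ∏ i, g i → ∃ (i : Fin r) (D : Module.Dual R V),
    ¬ p ∣ (∏ j ∈ Finset.univ.erase i, g j) *
      (((a i : R) * ∏ j ∈ Finset.univ.erase i, g j ^ a j) * D (w i))

namespace LogData

variable {I : Ideal R} {n : ℕ} {g : Fin r → R} {w : Fin r → V} {a : Fin r → ℕ} {dF : V}

theorem smul_logMap (h : LogData I n g w a dF) (u : ExteriorAlgebra R (V × (Fin r → R))) :
    (∏ i, g i ^ a i) • logMap g w a u = ι R dF * residueMap g w u := by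
  have h1 : weightVector R V a =
      ∑ i, (a i : R) • ((0, Pi.single i 1) : V × (Fin r → R)) := by
    ext j
    · simp [weightVector, Prod.fst_sum]
    · simp [weightVector, Prod.snd_sum, Finset.sum_apply, Pi.single_apply]
  rw [logMap_apply, h1, h.eq_sum]
  simp only [map_sum, map_smul, Finset.sum_mul, smul_mul_assoc, Finset.smul_sum]
  refine Finset.sum_congr rfl fun i _ => ?_
  rw [← smul_residueMap_single_mul, smul_smul, smul_smul,
    ← Finset.mul_prod_erase Finset.univ (fun i => g i ^ a i) (Finset.mem_univ i)]
  congr 1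
  obtain ⟨b, hb⟩ : ∃ b, a i = b + 1 := ⟨a i - 1, by have := h.pos i; omega⟩
  simp only [hb, Nat.add_sub_cancel, pow_succ]
  ring

theorem logMap_mem_wedgeKer (h : LogData I n g w a dF) {k : ℕ}
    {c : ExteriorAlgebra R (V × (Fin r → R))} (hc : c ∈ ⋀[R]^k (V × (Fin r → R))) :
    logMap g w a c ∈ wedgeKer dF (k + 1) := by
  refine mem_wedgeKer.2 ⟨residueMap_mem g w (ι_mul_mem _ hc), ?_⟩
  rw [logMap_apply, ← h.smul_logMap, logMap_apply, ι_mul_ι_mul_self, map_zero, smul_zero]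

variable [IsDomain R]

theorem prod_pow_ne_zero (h : LogData I n g w a dF) : ∏ i, g i ^ a i ≠ 0 :=
  Finset.prod_ne_zero_iff.2 fun i _ => pow_ne_zero _ (h.ne_zero i)

variable [Module.Free R V]

theorem smul_eq_residueMap (h : LogData I n g w a dF) {k : ℕ}
    {z : ExteriorAlgebra R V} (hz : z ∈ wedgeKer dF (k + 1)) (i : Fin r) (D : Module.Dual R V) :
    ∃ c ∈ ⋀[R]^(k + 1) (V × (Fin r → R)), ((∏ j ∈ Finset.univ.erase i, g j) *
      (((a i : R) * ∏ j ∈ Finset.univ.erase i, g j ^ a j) * D (w i))) • z =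
        residueMap g w c := by
  obtain ⟨u, hu⟩ := h.leibniz i
  obtain ⟨hz1, hz2⟩ := mem_wedgeKer.1 hz
  set q := ∏ j ∈ Finset.univ.erase i, g j with hq
  set t := (a i : R) * ∏ j ∈ Finset.univ.erase i, g j ^ a j with ht
  have h1 : t • (ι R (w i) * z) + g i • (ι R u * z) = 0 := by
    refine (smul_eq_zero.1 ?_).resolve_left (pow_ne_zero (a i - 1) (h.ne_zero i))
    rw [← hz2, hu, map_add, map_smul, map_smul, add_mul, smul_mul_assoc, smul_mul_assoc, smul_add,
      smul_smul, smul_smul, ← pow_succ, Nat.sub_add_cancel (h.pos i), ht]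
    congr 2
    ring
  have h2 := congrArg (interiorProd D) h1
  rw [map_zero, map_add, map_smul, map_smul, interiorProd_ι_mul, smul_sub, smul_smul] at h2
  have hD := interiorProd_mem D hz1
  have h3 : residueMap g w (ι R ((0, Pi.single i 1) : V × (Fin r → R)) *
      extendForm R V r (interiorProd D z)) = q • (ι R (w i) * interiorProd D z) := by
    refine smul_right_injective _ (h.ne_zero i) ?_
    simp only
    rw [smul_residueMap_single_mul, residueMap_extendForm, mul_smul_comm, smul_smul,
      ← Finset.mul_prod_erase Finset.univ g (Finset.mem_univ i)]
  refine ⟨t • (ι R ((0, Pi.single i 1) : V × (Fin r → R)) *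
      extendForm R V r (interiorProd D z)) -
      extendForm R V r (interiorProd D (ι R u * z)), ?_, ?_⟩
  · refine Submodule.sub_mem _ (Submodule.smul_mem _ _ (ι_mul_mem _ (map_mem _ hD))) (map_mem _ ?_)
    exact interiorProd_mem D (ι_mul_mem _ hz1)
  · rw [map_sub, map_smul, h3, residueMap_extendForm,
      ← Finset.mul_prod_erase Finset.univ g (Finset.mem_univ i), ← hq, mul_smul q, mul_comm (g i),
      mul_smul q, smul_comm t q, ← smul_sub]
    congr 1
    rw [sub_add_eq_add_sub, sub_eq_zero] at h2
    rw [eq_sub_iff_add_eq, h2]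

variable [Module.Finite R V]

theorem logMap_eq_zero_iff (h : LogData I n g w a dF) {k : ℕ} (hk : k < n)
    {c : ExteriorAlgebra R (V × (Fin r → R))} (hc : c ∈ ⋀[R]^k (V × (Fin r → R))) :
    logMap g w a c = 0 ↔ c ∈ wedgeIdeal (logSections g w a) k := by
  refine ⟨fun h0 => ?_, logMap_eq_zero_of_mem g w a⟩
  refine mem_wedgeIdeal_of_prod_eq_zero h.depth h.indep hk hc ?_
  have h1 := elimList_sub_mem g w (List.finRange r) (ι_mul_mem (weightVector R V a) hc)
  rw [← extendForm_residueMap g w h.ne_zero, ← logMap_apply, h0, map_zero, zero_sub] at h1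
  have h2 := prod_ι_mul_eq_zero h1
  obtain ⟨ε, h3, h4, -⟩ := ι_mul_prod_ι (R := R) ((List.finRange r).map (graphSection g w))
  rw [mul_neg, neg_eq_zero, mul_smul_comm, smul_eq_zero] at h2
  rw [logSections, List.map_cons, List.prod_cons, mul_assoc, h4, h2.resolve_left, smul_zero]
  rw [← List.ofFn_eq_map, List.prod_ofFn]
  exact Finset.prod_ne_zero_iff.2 fun i _ => h.ne_zero i

/-- The image of the logarithmic forms of degree `k`. -/
theorem depth_map_logMap (h : LogData I n g w a dF) {k : ℕ} (hk : k < n) :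
    SubquotientDepthGE I (n - k) ⊥ ((⋀[R]^k (V × (Fin r → R))).map (logMap g w a)) :=
  (wedgeIdeal_depth h.depth _ h.indep k hk.le).map _ fun _ hb => h.logMap_eq_zero_iff hk hb

theorem smul_mem_of_residueMap (h : LogData I n g w a dF) {k : ℕ} (hk : k + 1 < n) {x : R}
    {z : ExteriorAlgebra R V} (hz : z ∈ wedgeKer dF (k + 1))
    {c : ExteriorAlgebra R (V × (Fin r → R))} (hc : c ∈ ⋀[R]^(k + 1) (V × (Fin r → R)))
    (hx : x • z = residueMap g w c) :
    x • z ∈ (⋀[R]^k (V × (Fin r → R))).map (logMap g w a) := by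
  have h1 : logMap g w a c = 0 := by
    have h2 := h.smul_logMap c
    rw [← hx, mul_smul_comm, (mem_wedgeKer.1 hz).2, smul_zero] at h2
    exact (smul_eq_zero.1 h2).resolve_left h.prod_pow_ne_zero
  rw [h.logMap_eq_zero_iff hk hc] at h1
  obtain ⟨y, hy, _, ⟨c', hc', rfl⟩, rfl⟩ := Submodule.mem_sup.1 h1
  refine ⟨c', hc', ?_⟩
  rw [hx, map_add, LinearMap.mulLeft_apply, logMap_apply]
  rw [residueMap, LinearMap.comp_apply, LinearMap.comp_apply,
    elimList_eq_zero g w _ _ (fun i hi => hi) hy, map_zero, zero_add]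

theorem mem_of_prime_smul_mem (h : LogData I n g w a dF) {k : ℕ} (hk : k + 1 < n) {q x : R}
    (hq : Prime q) (hx : ¬ q ∣ x) {z : ExteriorAlgebra R V}
    (h1 : q • z ∈ (⋀[R]^k (V × (Fin r → R))).map (logMap g w a))
    (h2 : x • z ∈ (⋀[R]^k (V × (Fin r → R))).map (logMap g w a)) :
    z ∈ (⋀[R]^k (V × (Fin r → R))).map (logMap g w a) := by
  obtain ⟨c, hc, hcz⟩ := h1
  obtain ⟨c', hc', hcz'⟩ := h2
  have h3 : x • c - q • c' ∈ wedgeIdeal (logSections g w a) k := by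
    rw [← h.logMap_eq_zero_iff (by omega)
      (Submodule.sub_mem _ (Submodule.smul_mem _ _ hc) (Submodule.smul_mem _ _ hc')), map_sub,
      map_smul, map_smul, hcz, hcz', smul_comm, sub_self]
  obtain ⟨y, hy, _, ⟨b, hb, rfl⟩, hyb⟩ := Submodule.mem_sup.1
    (mem_wedgeIdeal_sup_of_smul_mem h.depth h.indep hk hc hq hx
      (Submodule.mem_sup.2 ⟨_, h3, _, ⟨c', hc', rfl⟩, sub_add_cancel _ _⟩))
  refine ⟨b, hb, smul_right_injective _ hq.ne_zero ?_⟩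
  simp only
  rw [← hcz, ← hyb, map_add, logMap_eq_zero_of_mem g w a hy, zero_add, LinearMap.lsmul_apply, map_smul]

theorem wedgeKer_eq_map [UniqueFactorizationMonoid R] (h : LogData I n g w a dF) {k : ℕ}
    (hk : k + 1 < n) :
    wedgeKer dF (k + 1) = (⋀[R]^k (V × (Fin r → R))).map (logMap g w a) := by
  refine le_antisymm (fun z hz => ?_) ?_
  · have key : ∀ b : R, b ∣ ∏ i, g i → ∀ z ∈ wedgeKer dF (k + 1),
        b • z ∈ (⋀[R]^k (V × (Fin r → R))).map (logMap g w a) →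
        z ∈ (⋀[R]^k (V × (Fin r → R))).map (logMap g w a) := by
      intro b
      induction b using UniqueFactorizationMonoid.induction_on_prime with
      | h₁ =>
        intro h0
        exact absurd (zero_dvd_iff.1 h0) (Finset.prod_ne_zero_iff.2 fun i _ => h.ne_zero i)
      | h₂ x hx =>
        intro _ z _ hxz
        obtain ⟨y, hy⟩ := hx.exists_left_inv
        rw [← one_smul R z, ← hy, mul_smul]
        exact Submodule.smul_mem _ _ hxz
      | h₃ b p hb hp ih =>
        intro hpb z hz hpbz
        refine ih (dvd_of_mul_left_dvd hpb) z hz ?_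
        obtain ⟨i, D, hD⟩ := h.exists_not_dvd p hp (dvd_of_mul_right_dvd hpb)
        have hbz : b • z ∈ wedgeKer dF (k + 1) := Submodule.smul_mem _ _ hz
        obtain ⟨c, hc, hcz⟩ := h.smul_eq_residueMap hbz i D
        exact h.mem_of_prime_smul_mem hk hp hD (by rwa [← mul_smul])
          (h.smul_mem_of_residueMap hk hbz hc hcz)
    exact key _ dvd_rfl z hz (h.smul_mem_of_residueMap hk hz (map_mem _ (mem_wedgeKer.1 hz).1)
      (residueMap_extendForm g w z).symm)
  · rintro _ ⟨c, hc, rfl⟩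
    exact h.logMap_mem_wedgeKer hc

theorem depth_wedgeKer [UniqueFactorizationMonoid R] (h : LogData I n g w a dF) {k : ℕ}
    (hk : k + 1 < n) : SubquotientDepthGE I (n - k) ⊥ (wedgeKer dF (k + 1)) := by
  rw [h.wedgeKer_eq_map hk]
  exact h.depth_map_logMap (by omega)

end LogData

end LogForms

section TwoDifferentials

open ExteriorAlgebra

variable {R : Type} [CommRing R] {V : Type} [AddCommGroup V] [Module R V]

/-- The image of wedge product with `v` on `j`-forms plus the image of wedge product with `w` on
the `j`-forms annihilated by `v`. -/
noncomputable def wedgeSum (v w : V) : ℕ → Submodule R (ExteriorAlgebra R V)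
  | 0 => ⊥
  | j + 1 => (⋀[R]^j V).map (LinearMap.mulLeft R (ι R v)) ⊔
      (wedgeKer v j).map (LinearMap.mulLeft R (ι R w))

/-- The image of wedge product with `v` in degree `j`. -/
noncomputable def wedgeImage (v : V) : ℕ → Submodule R (ExteriorAlgebra R V)
  | 0 => ⊥
  | j + 1 => (⋀[R]^j V).map (LinearMap.mulLeft R (ι R v))

theorem ι_mul_mem_wedgeImage (v : V) {j : ℕ} {u : ExteriorAlgebra R V} (hu : u ∈ ⋀[R]^j V) :
    ι R v * u ∈ wedgeImage v (j + 1) := ⟨u, hu, rfl⟩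

theorem wedgeKer_zero_eq_bot [IsDomain R] [Module.Free R V] {v : V} (hv : v ≠ 0) :
    wedgeKer (R := R) v 0 = ⊥ := by
  refine (Submodule.eq_bot_iff _).2 fun z hz => ?_
  obtain ⟨h1, h2⟩ := mem_wedgeKer.1 hz
  rw [exteriorPower, pow_zero] at h1
  obtain ⟨x, rfl⟩ := Submodule.mem_one.1 h1
  rw [← Algebra.commutes, ← Algebra.smul_def, ← map_smul, ι_eq_zero_iff, smul_eq_zero] at h2
  rw [h2.resolve_right hv, map_zero]

theorem wedgeImage_le_wedgeSum (v w : V) (j : ℕ) :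
    wedgeImage (R := R) v j ≤ wedgeSum v w j := by
  cases j with
  | zero => exact le_rfl
  | succ j => exact le_sup_left

theorem ι_mul_mem_wedgeKer {v : V} (w : V) {j : ℕ} {u : ExteriorAlgebra R V}
    (hu : u ∈ wedgeKer v j) : ι R w * u ∈ wedgeKer v (j + 1) := by
  obtain ⟨h1, h2⟩ := mem_wedgeKer.1 hu
  exact mem_wedgeKer.2 ⟨ι_mul_mem w h1, by rw [ι_mul_ι_mul_swap, h2, mul_zero, neg_zero]⟩

theorem ι_mul_mem_wedgeImage_of_mem_wedgeSum {v w : V} {j : ℕ} {u : ExteriorAlgebra R V}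
    (hu : u ∈ wedgeSum v w j) : ι R w * u ∈ wedgeImage v (j + 1) := by
  cases j with
  | zero => rw [(Submodule.mem_bot R).1 hu, mul_zero]; exact Submodule.zero_mem _
  | succ j =>
    obtain ⟨_, ⟨x, hx, rfl⟩, _, ⟨y, hy, rfl⟩, rfl⟩ := Submodule.mem_sup.1 hu
    rw [LinearMap.mulLeft_apply, LinearMap.mulLeft_apply, mul_add, ι_mul_ι_mul_self, add_zero,
      ι_mul_ι_mul_swap, ← mul_neg]
    exact ι_mul_mem_wedgeImage v (Submodule.neg_mem _ (ι_mul_mem w hx))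

theorem smul_mem_wedgeSum {v w : V} {j : ℕ} {u : ExteriorAlgebra R V}
    (hu : u ∈ wedgeKer v (j + 1)) (hwu : ι R w * u ∈ wedgeImage v (j + 2)) {x : R}
    (hx : x ∈ valueIdeal R v [] ⊔ valueIdeal R w [v]) : x • u ∈ wedgeSum v w (j + 1) := by
  obtain ⟨h1, h2⟩ := mem_wedgeKer.1 hu
  obtain ⟨y, hy, z, hz, rfl⟩ := Submodule.mem_sup.1 hx
  rw [add_smul]
  refine Submodule.add_mem _ ?_ ?_
  · obtain ⟨D, -, rfl⟩ := mem_valueIdeal.1 hy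
    have h3 := interiorProd_ι_mul D v u
    rw [h2, map_zero, eq_comm, sub_eq_zero] at h3
    rw [h3]
    exact wedgeImage_le_wedgeSum _ _ _ (ι_mul_mem_wedgeImage v (interiorProd_mem D h1))
  · obtain ⟨D, hD, rfl⟩ := mem_valueIdeal.1 hz
    have hDv : D v = 0 := hD v (by simp)
    obtain ⟨ξ, hξ, hwξ⟩ := hwu
    have h3 := interiorProd_ι_mul D w u
    rw [← hwξ, LinearMap.mulLeft_apply, interiorProd_ι_mul, hDv, zero_smul, zero_sub,
      eq_sub_iff_add_eq] at h3
    rw [← h3]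
    refine Submodule.add_mem _ ?_ ?_
    · rw [← mul_neg]
      exact wedgeImage_le_wedgeSum _ _ _
        (ι_mul_mem_wedgeImage v (Submodule.neg_mem _ (interiorProd_mem D hξ)))
    · refine Submodule.mem_sup_right ⟨_, mem_wedgeKer.2 ⟨interiorProd_mem D h1, ?_⟩, rfl⟩
      have h4 := interiorProd_ι_mul D v u
      rwa [h2, map_zero, hDv, zero_smul, zero_sub, eq_comm, neg_eq_zero] at h4

variable [IsDomain R] [Module.Free R V] {I : Ideal R} {n : ℕ} {v w : V}

theorem mem_wedgeSum_of_depth (hI : I ≤ (valueIdeal R v [] ⊔ valueIdeal R w [v]).radical) {j : ℕ}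
    (hj : j < n) (h : SubquotientDepthGE I (n - j) (wedgeSum v w j) (wedgeKer v j)) (hv : v ≠ 0)
    {u : ExteriorAlgebra R V} (hu : u ∈ wedgeKer v j)
    (hwu : ι R w * u ∈ wedgeImage v (j + 1)) : u ∈ wedgeSum v w j := by
  cases j with
  | zero => exact (wedgeKer_zero_eq_bot hv).le hu
  | succ j => exact h.mem (by omega) hu hI fun x hx => smul_mem_wedgeSum hu hwu hx

variable [Module.Finite R V]

theorem depth_wedgeImage (hR : DepthGE I n R) (hv : v ≠ 0)
    (hZ : ∀ k, k + 1 < n → SubquotientDepthGE I (n - k) ⊥ (wedgeKer v (k + 1))) {j : ℕ}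
    (hj : j < n) : SubquotientDepthGE I (n - j) ⊥ (wedgeImage v (j + 1)) := by
  have h1 : SubquotientDepthGE I (n - j + 1) ⊥ (wedgeKer (R := R) v j) := by
    cases j with
    | zero => exact .of_le (wedgeKer_zero_eq_bot hv).le
    | succ j => exact (hZ j hj).mono (by omega)
  have h2 := h1.of_map (A' := ⊥) (B' := ⋀[R]^j V)
    ((SubquotientDepthGE.bot hR.of_free).mono (Nat.sub_le _ _)) LinearMap.id (fun b hb => hb.1)
    (fun b hb => hb) (fun b _ hb => hb)
  refine h2.map _ fun b hb => ?_
  rw [bot_sup_eq, Submodule.map_id]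
  exact (and_iff_right hb).symm

theorem depth_wedgeKer_wedgeImage (hR : DepthGE I n R) (hv : v ≠ 0)
    (hZ : ∀ k, k + 1 < n → SubquotientDepthGE I (n - k) ⊥ (wedgeKer v (k + 1))) {j : ℕ}
    (hj : j < n) : SubquotientDepthGE I (n - j) (wedgeImage v j) (wedgeKer v j) := by
  cases j with
  | zero => exact .of_le (wedgeKer_zero_eq_bot hv).le
  | succ j =>
    have h1 := ((depth_wedgeImage hR hv hZ (by omega : j < n)).mono
      (by omega : n - (j + 1) + 1 ≤ n - j)).of_map ((hZ j hj).mono (by omega)) LinearMap.id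
      (fun b hb => ?_) (fun b hb => hb) (fun b _ hb => hb)
    · rwa [bot_sup_eq, Submodule.map_id] at h1
    · obtain ⟨c, hc, rfl⟩ := hb
      exact mem_wedgeKer.2 ⟨ι_mul_mem v hc, ι_mul_ι_mul_self v c⟩

theorem depth_wedgeSum (hR : DepthGE I n R) (hv : v ≠ 0)
    (hZ : ∀ k, k + 1 < n → SubquotientDepthGE I (n - k) ⊥ (wedgeKer v (k + 1)))
    (hI : I ≤ (valueIdeal R v [] ⊔ valueIdeal R w [v]).radical) {j : ℕ} (hj : j < n) :
    SubquotientDepthGE I (n - j) (wedgeSum v w j) (wedgeKer v j) := by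
  induction j with
  | zero => exact .of_le (wedgeKer_zero_eq_bot hv).le
  | succ j ih =>
    have h := ih (by omega)
    exact (h.mono (by omega : n - (j + 1) + 1 ≤ n - j)).of_map
      (depth_wedgeKer_wedgeImage hR hv hZ hj) (LinearMap.mulLeft R (ι R w))
      (fun b hb => ι_mul_mem_wedgeKer w hb)
      (fun b hb => ι_mul_mem_wedgeImage_of_mem_wedgeSum hb)
      (fun b hb hb' => mem_wedgeSum_of_depth hI (by omega) h hv hb hb')

/-- A form in the kernel of `v ∧` which is mapped by `w ∧` to the image of `v ∧` is the sum of an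
element of the image of `v ∧` and the wedge product of `w` with an element of the kernel of
`v ∧`. -/
theorem mem_wedgeSum (hR : DepthGE I n R) (hv : v ≠ 0)
    (hZ : ∀ k, k + 1 < n → SubquotientDepthGE I (n - k) ⊥ (wedgeKer v (k + 1)))
    (hI : I ≤ (valueIdeal R v [] ⊔ valueIdeal R w [v]).radical) {j : ℕ} (hj : j < n)
    {u : ExteriorAlgebra R V} (hu : u ∈ wedgeKer v j)
    (hwu : ι R w * u ∈ wedgeImage v (j + 1)) : u ∈ wedgeSum v w j :=
  mem_wedgeSum_of_depth hI hj (depth_wedgeSum hR hv hZ hI hj) hv hu hwu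

end TwoDifferentials

section Cramer

theorem exists_submatrix_det_ne_zero {K m κ : Type} [Field K] [Fintype m] [DecidableEq m]
    [Fintype κ] (A : Matrix m κ K) (hA : LinearIndependent K A) :
    ∃ c : m → κ, (A.submatrix id c).det ≠ 0 := by
  classical
  obtain ⟨κ', e, he, hspan, hli⟩ := exists_linearIndependent' K A.col
  have hfin : Finite κ' := Finite.of_injective e he
  have := Fintype.ofFinite κ'
  have hcard : Fintype.card κ' = Fintype.card m := by
    rw [← finrank_span_eq_card hli, hspan, ← A.rank_eq_finrank_span_cols, hA.rank_matrix]
  let σ : m ≃ κ' := Fintype.equivOfCardEq hcard.symm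
  refine ⟨e ∘ σ, ?_⟩
  rw [← isUnit_iff_ne_zero, ← Matrix.isUnit_iff_isUnit_det,
    ← Matrix.linearIndependent_cols_iff_isUnit]
  exact hli.comp σ σ.injective

/-- Cramer's rule: sections which are linearly independent at a point can be separated by linear
forms. -/
theorem exists_dual_of_linearIndependent {R K m κ : Type} [CommRing R] [Field K] [Finite m]
    [Finite κ] (φ : R →+* K) (s : m → κ → R) (hs : LinearIndependent K fun i j => φ (s i j))
    (i : m) : ∃ D : Module.Dual R (κ → R), (∀ j, j ≠ i → D (s j) = 0) ∧ φ (D (s i)) ≠ 0 := by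
  classical
  have := Fintype.ofFinite m
  have := Fintype.ofFinite κ
  obtain ⟨c, hc⟩ := exists_submatrix_det_ne_zero (Matrix.of fun i j => φ (s i j)) hs
  let A : Matrix m m R := Matrix.of fun j l => s j (c l)
  have hA : ∀ j, ∑ l, A.adjugate l i • s j (c l) = A.det * (1 : Matrix m m R) j i := by
    intro j
    rw [← smul_eq_mul, ← Matrix.smul_apply, ← Matrix.mul_adjugate, Matrix.mul_apply]
    exact Finset.sum_congr rfl fun l _ => mul_comm _ _
  have hD : ∀ u, (∑ l, A.adjugate l i • LinearMap.proj (c l) : Module.Dual R (κ → R)) u =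
      ∑ l, A.adjugate l i • u (c l) := by
    intro u
    simp
  refine ⟨∑ l, A.adjugate l i • LinearMap.proj (c l), fun j hj => ?_, ?_⟩
  · rw [hD, hA, Matrix.one_apply_ne hj, mul_zero]
  · rw [hD, hA, Matrix.one_apply_eq, mul_one, RingHom.map_det]
    exact hc

end Cramer

section Nullstellensatz

theorem MvPolynomial.span_X_le_radical {k K σ : Type} [Field k] [Field K] [Algebra k K]
    [IsAlgClosed K] [Finite σ] {J : Ideal (MvPolynomial σ k)}
    (hJ : ∀ x : σ → K, (∀ p ∈ J, aeval x p = 0) → x = 0) :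
    Ideal.span (Set.range (X : σ → MvPolynomial σ k)) ≤ J.radical := by
  rw [← vanishingIdeal_zeroLocus_eq_radical (K := K), Ideal.span_le]
  rintro _ ⟨i, rfl⟩ x hx
  rw [hJ x hx, aeval_X, Pi.zero_apply]

theorem Derivation.map_prod' {k A M ι : Type} [CommRing k] [CommRing A] [Algebra k A]
    [AddCommGroup M] [Module A M] [Module k M] [DecidableEq ι] (D : Derivation k A M)
    (s : Finset ι) (f : ι → A) : D (∏ i ∈ s, f i) = ∑ i ∈ s, (∏ j ∈ s.erase i, f j) • D (f i) := by
  induction s using Finset.induction_on with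
  | empty => simp
  | insert i s hi ih =>
    rw [Finset.prod_insert hi, D.leibniz, ih, Finset.sum_insert hi, Finset.erase_insert hi,
      Finset.smul_sum, add_comm]
    congr 1
    refine Finset.sum_congr rfl fun j hj => ?_
    rw [Finset.erase_insert_of_ne (by rintro rfl; exact hi hj), Finset.prod_insert (by simp [hi]), smul_smul]

end Nullstellensatz

section SmoothFactorization

/-- The vector of partial derivatives. -/
noncomputable def MvPolynomial.grad {k : Type} [Field k] {n : ℕ} (f : MvPolynomial (Fin n) k) :
    Fin n → MvPolynomial (Fin n) k := fun j => pderiv j f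

/-- Homogeneous polynomials `F = ∏ g_i ^ a_i` and `G` such that the `g_i`, respectively `G` and the
`g_i`, have normal crossings away from the origin, over the algebraically closed field `K`. -/
structure SmoothFactorization (K : Type) {k : Type} [Field k] [Field K] [Algebra k K] {n r : ℕ}
    (g : Fin r → MvPolynomial (Fin n) k) (a d : Fin r → ℕ) (F G : MvPolynomial (Fin n) k)
    (δ δ' : ℕ) : Prop where
  isHomogeneous : ∀ i, (g i).IsHomogeneous (d i)
  isHomogeneous_left : F.IsHomogeneous δ
  isHomogeneous_right : G.IsHomogeneous δ'
  pos : ∀ i, 0 < a i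
  eq_prod : F = ∏ i, g i ^ a i
  ne_zero : F ≠ 0
  cast_left_ne_zero : (δ : k) ≠ 0
  cast_right_ne_zero : (δ' : k) ≠ 0
  cast_ne_zero : ∀ i, (a i : k) ≠ 0
  independent : ∀ x : Fin n → K, x ≠ 0 → ∀ s : Finset (Fin r), s.Nonempty →
    (∀ i ∈ s, aeval x (g i) = 0) → ∀ c : Fin r → K, (∀ i ∉ s, c i = 0) →
    (∀ l, ∑ i, c i * aeval x (pderiv l (g i)) = 0) → c = 0
  independent_insert : ∀ x : Fin n → K, x ≠ 0 → ∀ s : Finset (Fin r),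
    (2 ≤ s.card ∨ ∃ i ∈ s, s.card = 1 ∧ 1 < a i) →
    (∀ i ∈ s, aeval x (g i) = 0) → aeval x G = 0 → ∀ (b : K) (c : Fin r → K),
    (∀ i ∉ s, c i = 0) →
    (∀ l, b * aeval x (pderiv l G) + ∑ i, c i * aeval x (pderiv l (g i)) = 0) → b = 0

theorem MvPolynomial.sum_mul_aeval_pderiv_of_isHomogeneous {k K : Type} [Field k] [Field K]
    [Algebra k K] {n e : ℕ} {f : MvPolynomial (Fin n) k} (hf : f.IsHomogeneous e) (x : Fin n → K) :
    ∑ l, x l * aeval x (pderiv l f) = (e : K) * aeval x f := by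
  have h := congrArg (aeval x) hf.sum_X_mul_pderiv
  simpa using h

namespace SmoothFactorization

variable {k K : Type} [Field k] [Field K] [Algebra k K] {n r : ℕ}
  {g : Fin r → MvPolynomial (Fin n) k} {a d : Fin r → ℕ} {F G : MvPolynomial (Fin n) k} {δ δ' : ℕ}

theorem factor_ne_zero (h : SmoothFactorization K g a d F G δ δ') (i : Fin r) : g i ≠ 0 := by
  intro hi
  refine h.ne_zero (h.eq_prod.trans (Finset.prod_eq_zero (Finset.mem_univ i) ?_))
  rw [hi, zero_pow (h.pos i).ne']

theorem sum_mul_degree (h : SmoothFactorization K g a d F G δ δ') : ∑ i, a i * d i = δ := by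
  refine IsHomogeneous.inj_right ?_ h.isHomogeneous_left h.ne_zero
  rw [h.eq_prod]
  refine IsHomogeneous.prod _ _ _ fun i _ => ?_
  rw [mul_comm]
  exact (h.isHomogeneous i).pow (a i)

theorem grad_ne_zero (h : SmoothFactorization K g a d F G δ δ') : grad F ≠ 0 := by
  intro h0
  have h1 := h.isHomogeneous_left.sum_X_mul_pderiv
  have h2 : ∀ l, pderiv l F = 0 := fun l => congrFun h0 l
  simp only [h2, mul_zero, Finset.sum_const_zero, nsmul_eq_mul] at h1
  have h3 : ((δ : ℕ) : MvPolynomial (Fin n) k) ≠ 0 := by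
    rw [← map_natCast (C : k →+* MvPolynomial (Fin n) k)]
    exact fun h3 => h.cast_left_ne_zero ((map_eq_zero_iff _ (C_injective _ _)).1 h3)
  exact (mul_ne_zero h3 h.ne_zero) h1.symm

theorem grad_eq_sum (h : SmoothFactorization K g a d F G δ δ') :
    grad F = ∑ i, ((a i : MvPolynomial (Fin n) k) *
      (g i ^ (a i - 1) * ∏ j ∈ Finset.univ.erase i, g j ^ a j)) • grad (g i) := by
  ext1 l
  rw [grad, h.eq_prod, Derivation.map_prod', Finset.sum_apply]
  refine Finset.sum_congr rfl fun i _ => ?_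
  rw [Derivation.leibniz_pow, Pi.smul_apply, grad]
  simp only [smul_eq_mul, nsmul_eq_mul]
  ring

theorem grad_leibniz (h : SmoothFactorization K g a d F G δ δ') (i : Fin r) :
    grad F = ((a i : MvPolynomial (Fin n) k) *
      (g i ^ (a i - 1) * ∏ j ∈ Finset.univ.erase i, g j ^ a j)) • grad (g i) +
      g i ^ a i • grad (∏ j ∈ Finset.univ.erase i, g j ^ a j) := by
  ext1 l
  simp only [grad, Pi.add_apply, Pi.smul_apply, smul_eq_mul]
  rw [h.eq_prod, ← Finset.mul_prod_erase Finset.univ (fun i => g i ^ a i) (Finset.mem_univ i),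
    Derivation.leibniz, Derivation.leibniz_pow]
  simp only [smul_eq_mul, nsmul_eq_mul]
  ring

theorem cast_ne_zero' (h : SmoothFactorization K g a d F G δ δ') (i : Fin r) : (a i : K) ≠ 0 := by
  rw [← map_natCast (algebraMap k K)]
  exact (map_ne_zero _).2 (h.cast_ne_zero i)

/-- The logarithmic sections are linearly independent at every point except the origin. -/
theorem eq_zero_of_relation (h : SmoothFactorization K g a d F G δ δ') {x : Fin n → K}
    (hx : x ≠ 0) {b : K} {c : Fin r → K} (h1 : ∀ i, b * a i + c i * aeval x (g i) = 0)
    (h2 : ∀ l, ∑ i, c i * aeval x (pderiv l (g i)) = 0) : b = 0 ∧ c = 0 := by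
  classical
  by_cases hs : ∃ i, aeval x (g i) = 0
  · obtain ⟨i, hi⟩ := hs
    have hb : b = 0 := by
      have h3 := h1 i
      rw [hi, mul_zero, add_zero, mul_eq_zero] at h3
      exact h3.resolve_right (h.cast_ne_zero' i)
    refine ⟨hb, ?_⟩
    refine h.independent x hx (Finset.univ.filter fun i => aeval x (g i) = 0) ⟨i, by simp [hi]⟩
      (fun j hj => (Finset.mem_filter.1 hj).2) c (fun j hj => ?_) h2
    have h3 := h1 j
    rw [hb, zero_mul, zero_add, mul_eq_zero] at h3
    exact h3.resolve_right (by simpa using hj)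
  · push Not at hs
    have h3 : ∑ i, c i * ((d i : K) * aeval x (g i)) = 0 := by
      simp_rw [← sum_mul_aeval_pderiv_of_isHomogeneous (h.isHomogeneous _) x, Finset.mul_sum]
      rw [Finset.sum_comm]
      refine Finset.sum_eq_zero fun l _ => ?_
      rw [← mul_zero (x l), ← h2 l, Finset.mul_sum]
      exact Finset.sum_congr rfl fun i _ => by ring
    have h4 : b * (δ : K) = 0 := by
      rw [← h.sum_mul_degree, Nat.cast_sum, Finset.mul_sum, ← neg_zero, ← h3,
        ← Finset.sum_neg_distrib]
      refine Finset.sum_congr rfl fun i _ => ?_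
      push_cast
      linear_combination (d i : K) * h1 i
    have hδ : (δ : K) ≠ 0 := by
      rw [← map_natCast (algebraMap k K)]
      exact (map_ne_zero _).2 h.cast_left_ne_zero
    have hb := (mul_eq_zero.1 h4).resolve_right hδ
    refine ⟨hb, funext fun i => ?_⟩
    have h5 := h1 i
    rw [hb, zero_mul, zero_add, mul_eq_zero] at h5
    exact h5.resolve_right (hs i)

theorem exists_factor_eq_zero (h : SmoothFactorization K g a d F G δ δ') {x : Fin n → K}
    (hF : ∀ l, aeval x (pderiv l F) = 0) : ∃ i, aeval x (g i) = 0 := by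
  have h1 := sum_mul_aeval_pderiv_of_isHomogeneous h.isHomogeneous_left x
  simp only [hF, mul_zero, Finset.sum_const_zero] at h1
  have hδ : (δ : K) ≠ 0 := by
    rw [← map_natCast (algebraMap k K)]
    exact (map_ne_zero _).2 h.cast_left_ne_zero
  have h2 := (mul_eq_zero.1 h1.symm).resolve_left hδ
  rw [h.eq_prod, map_prod, Finset.prod_eq_zero_iff] at h2
  obtain ⟨i, -, hi⟩ := h2
  rw [map_pow] at hi
  exact ⟨i, eq_zero_of_pow_eq_zero hi⟩

theorem two_le_card_or (h : SmoothFactorization K g a d F G δ δ') {x : Fin n → K} (hx : x ≠ 0)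
    (hF : ∀ l, aeval x (pderiv l F) = 0) {s : Finset (Fin r)}
    (hs : ∀ i, i ∈ s ↔ aeval x (g i) = 0) : 2 ≤ s.card ∨ ∃ i ∈ s, s.card = 1 ∧ 1 < a i := by
  obtain ⟨i, hi⟩ := h.exists_factor_eq_zero hF
  by_contra hcon
  push Not at hcon
  have hcard : s.card = 1 := by
    have := Finset.card_pos.2 ⟨i, (hs i).2 hi⟩
    omega
  have hai : a i = 1 := le_antisymm (hcon.2 i ((hs i).2 hi) hcard) (h.pos i)
  obtain ⟨i', rfl⟩ := Finset.card_eq_one.1 hcard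
  obtain rfl : i = i' := Finset.mem_singleton.1 ((hs i).2 hi)
  have hU : aeval x (∏ j ∈ Finset.univ.erase i, g j ^ a j) ≠ 0 := by
    rw [map_prod]
    refine Finset.prod_ne_zero_iff.2 fun j hj => ?_
    rw [map_pow]
    refine pow_ne_zero _ fun h0 => (Finset.mem_erase.1 hj).1 ?_
    exact Finset.mem_singleton.1 ((hs j).2 h0)
  have h0 := h.independent x hx {i} (Finset.singleton_nonempty i)
    (fun j hj => by rwa [Finset.mem_singleton.1 hj]) (Pi.single i 1)
    (fun j hj => Pi.single_eq_of_ne (by simpa using hj) _) fun l => by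
      rw [Finset.sum_eq_single i (fun j _ hj => by rw [Pi.single_eq_of_ne hj, zero_mul])
        (fun hi => absurd (Finset.mem_univ i) hi), Pi.single_eq_same, one_mul]
      have h1 := congrArg (aeval x) (congrFun (h.grad_leibniz i) l)
      simp only [grad, Pi.add_apply, Pi.smul_apply, smul_eq_mul, map_add, map_mul, hi, hF, hai, pow_one, zero_mul, add_zero, Nat.cast_one, Nat.sub_self, pow_zero,
        one_mul] at h1
      exact (mul_eq_zero.1 h1.symm).resolve_left hU
  have h1 := congrFun h0 i
  rw [Pi.single_eq_same] at h1
  exact one_ne_zero h1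

/-- At a critical point of `F` other than the origin, the logarithmic sections and the differential
of `G` are linearly independent. -/
theorem eq_zero_of_relation_insert (h : SmoothFactorization K g a d F G δ δ') {x : Fin n → K}
    (hx : x ≠ 0) (hF : ∀ l, aeval x (pderiv l F) = 0) {b b' : K} {c : Fin r → K}
    (h1 : ∀ i, b * a i + c i * aeval x (g i) = 0)
    (h2 : ∀ l, b' * aeval x (pderiv l G) + ∑ i, c i * aeval x (pderiv l (g i)) = 0) :
    b' = 0 ∧ b = 0 ∧ c = 0 := by
  classical
  suffices hb' : b' = 0 by
    refine ⟨hb', h.eq_zero_of_relation hx h1 fun l => ?_⟩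
    simpa [hb'] using h2 l
  obtain ⟨i, hi⟩ := h.exists_factor_eq_zero hF
  have hb : b = 0 := by
    have h3 := h1 i
    rw [hi, mul_zero, add_zero, mul_eq_zero] at h3
    exact h3.resolve_right (h.cast_ne_zero' i)
  have hc : ∀ j, c j * aeval x (g j) = 0 := fun j => by simpa [hb] using h1 j
  by_cases hG : aeval x G = 0
  · refine h.independent_insert x hx (Finset.univ.filter fun i => aeval x (g i) = 0)
      (h.two_le_card_or hx hF fun i => by simp) (fun j hj => (Finset.mem_filter.1 hj).2) hG b' c
      (fun j hj => (mul_eq_zero.1 (hc j)).resolve_right (by simpa using hj)) h2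
  · have h3 : ∑ l, x l * (b' * aeval x (pderiv l G) + ∑ i, c i * aeval x (pderiv l (g i))) = 0 :=
      Finset.sum_eq_zero fun l _ => by rw [h2 l, mul_zero]
    have h4 : ∑ l, x l * ∑ i, c i * aeval x (pderiv l (g i)) = 0 := by
      simp_rw [Finset.mul_sum]
      rw [Finset.sum_comm]
      refine Finset.sum_eq_zero fun i _ => ?_
      have h5 : ∀ l, x l * (c i * aeval x (pderiv l (g i))) =
          c i * (x l * aeval x (pderiv l (g i))) := fun l => by ring
      simp_rw [h5]
      rw [← Finset.mul_sum, sum_mul_aeval_pderiv_of_isHomogeneous (h.isHomogeneous i) x, mul_left_comm, hc,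
        mul_zero]
    have h6 : b' * ((δ' : K) * aeval x G) = 0 := by
      rw [← sum_mul_aeval_pderiv_of_isHomogeneous h.isHomogeneous_right x, Finset.mul_sum, ← h3]
      simp_rw [mul_add]
      rw [Finset.sum_add_distrib, h4, add_zero]
      exact Finset.sum_congr rfl fun l _ => by ring
    have hδ : (δ' : K) ≠ 0 := by
      rw [← map_natCast (algebraMap k K)]
      exact (map_ne_zero _).2 h.cast_right_ne_zero
    exact (mul_eq_zero.1 h6).resolve_right (mul_ne_zero hδ hG)

end SmoothFactorization

end SmoothFactorization

section SmoothLogData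

theorem exists_dual_prod_of_linearIndependent {R K m : Type} [CommRing R] [Field K] [Finite m]
    {n r : ℕ} (φ : R →+* K) (s : m → (Fin n → R) × (Fin r → R))
    (hs : ∀ c : m →₀ K, (∀ l, c.sum (fun i x => x * φ ((s i).1 l)) = 0) →
      (∀ j, c.sum (fun i x => x * φ ((s i).2 j)) = 0) → c = 0)
    (i : m) : ∃ D : Module.Dual R ((Fin n → R) × (Fin r → R)),
      (∀ j, j ≠ i → D (s j) = 0) ∧ φ (D (s i)) ≠ 0 := by
  let e := LinearEquiv.sumArrowLequivProdArrow (Fin n) (Fin r) R R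
  obtain ⟨D, h1, h2⟩ := exists_dual_of_linearIndependent φ (fun i => e.symm (s i))
    (linearIndependent_iff.2 fun c hc => by
      refine hs c (fun l => ?_) fun j => ?_
      · have h := congrFun hc (Sum.inl l)
        rwa [Finsupp.linearCombination_apply, Finsupp.sum_apply'] at h
      · have h := congrFun hc (Sum.inr j)
        rwa [Finsupp.linearCombination_apply, Finsupp.sum_apply'] at h) i
  exact ⟨D ∘ₗ e.symm.toLinearMap, h1, h2⟩

theorem independentOff_map {R L m : Type} [CommRing R] [AddCommGroup L] [Module R L] {I : Ideal R}
    (s : m → L) (h : ∀ (i : m) (l : List m), i ∉ l → I ≤ (valueIdeal R (s i) (l.map s)).radical)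
    {l : List m} (hl : l.Nodup) : IndependentOff I (l.map s) := by
  induction l with
  | nil => trivial
  | cons i l ih => exact ⟨h i l (List.nodup_cons.1 hl).1, ih (List.nodup_cons.1 hl).2⟩

namespace SmoothFactorization

variable {k K : Type} [Field k] [Field K] [Algebra k K] {n r : ℕ}
  {g : Fin r → MvPolynomial (Fin n) k} {a d : Fin r → ℕ} {F G : MvPolynomial (Fin n) k} {δ δ' : ℕ}

theorem logSections_eq_map (g : Fin r → MvPolynomial (Fin n) k) (a : Fin r → ℕ) :
    logSections g (fun i => grad (g i)) a =
      (none :: (List.finRange r).map some).map fun o : Option (Fin r) =>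
        o.elim (weightVector _ (Fin n → MvPolynomial (Fin n) k) a)
          (graphSection g fun i => grad (g i)) := by
  rw [logSections, List.map_cons, List.map_map]
  rfl

theorem exists_dual (h : SmoothFactorization K g a d F G δ δ') {x : Fin n → K} (hx : x ≠ 0)
    (o : Option (Fin r)) : ∃ D : Module.Dual (MvPolynomial (Fin n) k)
      ((Fin n → MvPolynomial (Fin n) k) × (Fin r → MvPolynomial (Fin n) k)),
      (∀ o', o' ≠ o → D (o'.elim (weightVector _ (Fin n → MvPolynomial (Fin n) k) a)
          (graphSection g fun i => grad (g i))) = 0) ∧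
      aeval x (D (o.elim (weightVector _ (Fin n → MvPolynomial (Fin n) k) a)
          (graphSection g fun i => grad (g i)))) ≠ 0 := by
  refine exists_dual_prod_of_linearIndependent (R := MvPolynomial (Fin n) k)
    ((aeval x : MvPolynomial (Fin n) k →ₐ[k] K) : MvPolynomial (Fin n) k →+* K) _ (fun c h1 h2 => ?_) o
  have hsum : ∀ φ : Option (Fin r) → K, c.sum (fun o x => x * φ o) =
      c none * φ none + ∑ i, c (some i) * φ (some i) := fun φ => by
    rw [Finsupp.sum_fintype _ _ fun _ => zero_mul _, Fintype.sum_option]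
  obtain ⟨hb, hc⟩ := h.eq_zero_of_relation hx (b := c none) (c := fun i => c (some i))
    (fun i => by
      have h3 := h2 i
      rw [hsum, Finset.sum_eq_single i (fun j _ hj => by
        simp [graphSection, Pi.single_eq_of_ne hj.symm]) fun hi => absurd (Finset.mem_univ i) hi] at h3
      simpa [weightVector, graphSection] using h3)
    (fun l => by
      have h3 := h1 l
      rw [hsum] at h3
      simpa [weightVector, graphSection, grad] using h3)
  ext o
  cases o with
  | none => exact hb
  | some i => exact congrFun hc i

variable [IsAlgClosed K]

theorem independentOff (h : SmoothFactorization K g a d F G δ δ') :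
    IndependentOff (Ideal.span (Set.range (X : Fin n → MvPolynomial (Fin n) k)))
      (logSections g (fun i => grad (g i)) a) := by
  rw [logSections_eq_map]
  refine independentOff_map _ (fun o l hol => span_X_le_radical (K := K) fun x hx => ?_) ?_
  · by_contra hx0
    obtain ⟨D, h1, h2⟩ := h.exists_dual hx0 o
    refine h2 (hx _ (mem_valueIdeal.2 ⟨D, fun u hu => ?_, rfl⟩))
    obtain ⟨o', ho', rfl⟩ := List.mem_map.1 hu
    exact h1 o' (by rintro rfl; exact hol ho')
  · refine List.nodup_cons.2 ⟨by simp, (List.nodup_finRange r).map (Option.some_injective _)⟩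

theorem le_radical_valueIdeal (h : SmoothFactorization K g a d F G δ δ') :
    Ideal.span (Set.range (X : Fin n → MvPolynomial (Fin n) k)) ≤
      (valueIdeal (MvPolynomial (Fin n) k) (grad F) [] ⊔
        valueIdeal (MvPolynomial (Fin n) k) (grad G) [grad F]).radical := by
  refine span_X_le_radical (K := K) fun x hx => ?_
  by_contra hx0
  have hF : ∀ l, aeval x (pderiv l F) = 0 := fun l =>
    hx _ (Ideal.mem_sup_left (mem_valueIdeal.2 ⟨LinearMap.proj l, by simp, rfl⟩))
  let s : Option (Option (Fin r)) →
      (Fin n → MvPolynomial (Fin n) k) × (Fin r → MvPolynomial (Fin n) k) := fun o =>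
    o.elim (grad G, 0) fun o => o.elim (weightVector _ (Fin n → MvPolynomial (Fin n) k) a)
      (graphSection g fun i => grad (g i))
  obtain ⟨D, h1, h2⟩ := exists_dual_prod_of_linearIndependent (R := MvPolynomial (Fin n) k)
    ((aeval x : MvPolynomial (Fin n) k →ₐ[k] K) : MvPolynomial (Fin n) k →+* K) s
    (fun c h1 h2 => by
      have hsum : ∀ φ : Option (Option (Fin r)) → K, c.sum (fun o x => x * φ o) =
          c none * φ none + (c (some none) * φ (some none) +
            ∑ i, c (some (some i)) * φ (some (some i))) := fun φ => by
        rw [Finsupp.sum_fintype _ _ fun _ => zero_mul _, Fintype.sum_option, Fintype.sum_option]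
      obtain ⟨hb', hb, hc⟩ := h.eq_zero_of_relation_insert hx0 hF (b := c (some none))
        (b' := -c none) (c := fun i => c (some (some i)))
        (fun i => by
          have h3 := h2 i
          rw [hsum, Finset.sum_eq_single i (fun j _ hj => by
            simp [s, graphSection, Pi.single_eq_of_ne hj.symm])
            fun hi => absurd (Finset.mem_univ i) hi] at h3
          simpa [s, weightVector, graphSection] using h3)
        (fun l => by
          have h3 := h1 l
          rw [hsum] at h3
          rw [← neg_zero, ← h3]
          simp [s, weightVector, graphSection, grad, add_comm])
      ext o
      match o with
      | none => exact neg_eq_zero.1 hb'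
      | some none => exact hb
      | some (some i) => exact congrFun hc i) none
  refine h2 (hx _ (Ideal.mem_sup_right (mem_valueIdeal.2
    ⟨D ∘ₗ LinearMap.inl _ _ _, fun u hu => ?_, rfl⟩)))
  obtain rfl := List.mem_singleton.1 hu
  have hθ := h1 (some none) (by simp)
  have hσ : ∀ i, D (LinearMap.inl _ _ _ (grad (g i))) = g i * D (0, Pi.single i 1) := fun i => by
    have h3 := h1 (some (some i)) (by simp)
    have h4 := smul_single_eq g (fun i => grad (g i)) i
    rw [← smul_eq_mul, ← map_smul, h4, map_add]
    simp only [s, Option.elim] at h3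
    rw [h3, zero_add]
  have hθ' : ∑ i, (a i : MvPolynomial (Fin n) k) * D (0, Pi.single i 1) = 0 := by
    have h3 : weightVector (MvPolynomial (Fin n) k) (Fin n → MvPolynomial (Fin n) k) a =
        ∑ i, (a i : MvPolynomial (Fin n) k) • ((0, Pi.single i 1) : (Fin n → MvPolynomial (Fin n) k) × (Fin r → MvPolynomial (Fin n) k)) := by
      ext1
      · simp [weightVector, Prod.fst_sum]
      · ext1 j
        simp [weightVector, Prod.snd_sum, Finset.sum_apply, Pi.single_apply]
    simp only [s, Option.elim] at hθ
    rw [h3, map_sum] at hθ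
    simpa only [map_smul, smul_eq_mul] using hθ
  rw [h.grad_eq_sum, map_sum, ← mul_zero (∏ i, g i ^ a i), ← hθ', Finset.mul_sum]
  refine Finset.sum_congr rfl fun i _ => ?_
  rw [map_smul, LinearMap.comp_apply, hσ, smul_eq_mul,
    ← Finset.mul_prod_erase Finset.univ (fun i => g i ^ a i) (Finset.mem_univ i)]
  obtain ⟨b, hb⟩ : ∃ b, a i = b + 1 := ⟨a i - 1, by have := h.pos i; omega⟩
  simp only [hb, Nat.add_sub_cancel, pow_succ]
  ring

theorem exists_zero_of_prime (hn : 2 ≤ n) {p : MvPolynomial (Fin n) k} (hp : Prime p) :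
    ∃ x : Fin n → K, x ≠ 0 ∧ aeval x p = 0 := by
  by_contra! hcon
  have h1 : Ideal.span (Set.range (X : Fin n → MvPolynomial (Fin n) k)) ≤ Ideal.span {p} := by
    have hI : (Ideal.span {p}).IsPrime := (Ideal.span_singleton_prime hp.ne_zero).2 hp
    rw [← hI.radical]
    refine span_X_le_radical (K := K) fun x hx => ?_
    by_contra hx0
    exact hcon x hx0 (hx p (Ideal.mem_span_singleton_self p))
  have h2 : ∀ i, p ∣ X i := fun i =>
    Ideal.mem_span_singleton.1 (h1 (Ideal.subset_span ⟨i, rfl⟩))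
  have h3 := hp.irreducible.associated_of_dvd (X_prime (i := (⟨0, by omega⟩ : Fin n))).irreducible
    (h2 _)
  have h4 := h3.dvd'.trans (h2 ⟨1, by omega⟩)
  rw [X_dvd_X] at h4
  simp at h4

theorem exists_not_dvd (h : SmoothFactorization K g a d F G δ δ') (hn : 2 ≤ n)
    {p : MvPolynomial (Fin n) k} (hp : Prime p) (hpg : p ∣ ∏ i, g i) :
    ∃ (i : Fin r) (D : Module.Dual (MvPolynomial (Fin n) k) (Fin n → MvPolynomial (Fin n) k)),
      ¬ p ∣ (∏ j ∈ Finset.univ.erase i, g j) *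
        (((a i : MvPolynomial (Fin n) k) * ∏ j ∈ Finset.univ.erase i, g j ^ a j) *
          D (grad (g i))) := by
  by_contra! hcon
  obtain ⟨x, hx, hpx⟩ := exists_zero_of_prime (K := K) hn hp
  obtain ⟨i, -, u, hu⟩ := (hp.dvd_finsetProd_iff _).1 hpg
  have hgi : aeval x (g i) = 0 := by rw [hu, map_mul, hpx, zero_mul]
  have hdg : ∀ {f v : MvPolynomial (Fin n) k} (_ : f = p * v) (l : Fin n),
      aeval x (pderiv l f) = aeval x v * aeval x (pderiv l p) := fun hf l => by
    rw [hf, Derivation.leibniz, map_add, smul_eq_mul, smul_eq_mul, map_mul, map_mul, hpx, zero_mul,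
      zero_add]
  have hne : ∃ l, aeval x (pderiv l (g i)) ≠ 0 := by
    by_contra! h0
    have h1 := h.independent x hx {i} (Finset.singleton_nonempty i)
      (fun j hj => by rwa [Finset.mem_singleton.1 hj]) (Pi.single i 1)
      (fun j hj => Pi.single_eq_of_ne (by simpa using hj) _) fun l => by
        rw [Finset.sum_eq_single i (fun j _ hj => by rw [Pi.single_eq_of_ne hj, zero_mul])
          (fun hi => absurd (Finset.mem_univ i) hi), h0, mul_zero]
    have h2 := congrFun h1 i
    rw [Pi.single_eq_same] at h2
    exact one_ne_zero h2
  obtain ⟨l, hl⟩ := hne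
  have hpl : ¬ p ∣ pderiv l (g i) := by
    rintro ⟨v, hv⟩
    rw [hv, map_mul, hpx, zero_mul] at hl
    exact hl rfl
  have hpa : ¬ p ∣ (a i : MvPolynomial (Fin n) k) := fun hpa => hp.not_isUnit
    (isUnit_of_dvd_unit hpa (by
      rw [← map_natCast (C : k →+* MvPolynomial (Fin n) k)]
      exact (h.cast_ne_zero i).isUnit.map C))
  obtain ⟨j, hji, v, hv⟩ : ∃ j, j ≠ i ∧ p ∣ g j := by
    have h1 := hcon i (LinearMap.proj l)
    rw [hp.dvd_mul, hp.dvd_mul, hp.dvd_mul, hp.dvd_finsetProd_iff, hp.dvd_finsetProd_iff] at h1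
    rcases h1 with ⟨j, hj, hpj⟩ | (hpa' | ⟨j, hj, hpj⟩) | hpl'
    · exact ⟨j, (Finset.mem_erase.1 hj).1, hpj⟩
    · exact absurd hpa' hpa
    · exact ⟨j, (Finset.mem_erase.1 hj).1, hp.dvd_of_dvd_pow hpj⟩
    · exact absurd hpl' hpl
  have hu0 : aeval x u ≠ 0 := fun hu0 => hl (by rw [hdg hu, hu0, zero_mul])
  have h1 := h.independent x hx {i, j} (Finset.insert_nonempty _ _)
    (fun m hm => by
      rcases Finset.mem_insert.1 hm with rfl | hm
      · exact hgi
      · rw [Finset.mem_singleton.1 hm, hv, map_mul, hpx, zero_mul])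
    (Pi.single i (aeval x v) - Pi.single j (aeval x u))
    (fun m hm => by
      simp only [Finset.mem_insert, Finset.mem_singleton, not_or] at hm
      rw [Pi.sub_apply, Pi.single_eq_of_ne hm.1, Pi.single_eq_of_ne hm.2, sub_zero]) fun l => by
      simp only [Pi.sub_apply, sub_mul, Finset.sum_sub_distrib]
      rw [Finset.sum_eq_single i (fun m _ hm => by rw [Pi.single_eq_of_ne hm, zero_mul])
          (fun hi => absurd (Finset.mem_univ i) hi),
        Finset.sum_eq_single j (fun m _ hm => by rw [Pi.single_eq_of_ne hm, zero_mul])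
          (fun hi => absurd (Finset.mem_univ j) hi), Pi.single_eq_same, Pi.single_eq_same, hdg hu,
        hdg hv]
      ring
  have h2 := congrFun h1 j
  rw [Pi.sub_apply, Pi.single_eq_of_ne hji, Pi.single_eq_same, zero_sub, Pi.zero_apply,
    neg_eq_zero] at h2
  exact hu0 h2

theorem logData (h : SmoothFactorization K g a d F G δ δ') (hn : 2 ≤ n) :
    LogData (Ideal.span (Set.range (X : Fin n → MvPolynomial (Fin n) k))) n g
      (fun i => grad (g i)) a (grad F) where
  depth := MvPolynomial.depthGE k n
  indep := h.independentOff
  ne_zero := h.factor_ne_zero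
  pos := h.pos
  eq_sum := h.grad_eq_sum
  leibniz i := ⟨_, h.grad_leibniz i⟩
  exists_not_dvd _ hp hpg := h.exists_not_dvd hn hp hpg

theorem mem_wedgeSum (h : SmoothFactorization K g a d F G δ δ') {j : ℕ} (hj : j < n)
    {u : ExteriorAlgebra (MvPolynomial (Fin n) k) (Fin n → MvPolynomial (Fin n) k)}
    (hu : u ∈ wedgeKer (grad F) j)
    (hGu : ExteriorAlgebra.ι _ (grad G) * u ∈ wedgeImage (grad F) (j + 1)) :
    u ∈ wedgeSum (grad F) (grad G) j :=
  _root_.mem_wedgeSum (MvPolynomial.depthGE k n) h.grad_ne_zero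
    (fun _ hk => (h.logData (by omega)).depth_wedgeKer hk) h.le_radical_valueIdeal hj hu hGu

end SmoothFactorization

end SmoothLogData

section FormComponent

theorem MvPolynomial.IsHomogeneous.homogeneousComponent_mul {σ R : Type} [CommRing R]
    {a : MvPolynomial σ R} {e : ℕ} (ha : a.IsHomogeneous e) (m : ℕ) (c : MvPolynomial σ R) :
    homogeneousComponent m (a * c) = if e ≤ m then a * homogeneousComponent (m - e) c else 0 := by
  have key : ∀ i, homogeneousComponent m (a * homogeneousComponent i c) =
      if e ≤ m then a * homogeneousComponent (m - e) (homogeneousComponent i c) else 0 := fun i => by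
    have hi := homogeneousComponent_isHomogeneous i c
    rw [homogeneousComponent_of_mem (ha.mul hi), homogeneousComponent_of_mem hi]
    by_cases h1 : m = e + i
    · rw [if_pos h1, if_pos (by omega), if_pos (by omega)]
    · rw [if_neg h1]
      by_cases h2 : e ≤ m
      · rw [if_pos h2, if_neg (by omega), mul_zero]
      · rw [if_neg h2]
  rw [← sum_homogeneousComponent c, Finset.mul_sum, map_sum, map_sum, Finset.mul_sum,
    Finset.sum_congr rfl fun i _ => key i]
  split_ifs
  · rfl
  · exact Finset.sum_const_zero

variable {F : Type} [Field F] {n : ℕ}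

/-- The basis of the exterior algebra given by the increasing products of the `dx_i`. -/
noncomputable def formBasis (F : Type) [Field F] (n : ℕ) :
    Module.Basis (Finset (Fin n)) (PolyRing F n) (FormAlgebra F n) :=
  (Pi.basisFun (PolyRing F n) (Fin n)).ExteriorAlgebra

/-- The part of a form whose coefficients are homogeneous of degree `m`. -/
noncomputable def formComponent (m : ℕ) : FormAlgebra F n →+ FormAlgebra F n where
  toFun v := ∑ s, homogeneousComponent m ((formBasis F n).repr v s) • formBasis F n s
  map_zero' := by simp
  map_add' := by simp [add_smul, Finset.sum_add_distrib]

theorem formComponent_smul_formBasis (m : ℕ) (c : PolyRing F n) (s : Finset (Fin n)) :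
    formComponent m (c • formBasis F n s) = homogeneousComponent m c • formBasis F n s := by
  change ∑ t, homogeneousComponent m ((formBasis F n).repr (c • formBasis F n s) t) •
    formBasis F n t = _
  rw [Finset.sum_eq_single s]
  · simp
  · intro t _ hts
    simp [hts.symm]
  · exact fun h => absurd (Finset.mem_univ s) h

theorem ι_single_eq_formBasis (i : Fin n) :
    ExteriorAlgebra.ι (PolyRing F n) (Pi.single i (1 : PolyRing F n)) = formBasis F n {i} := by
  have h0 := Finset.mem_singleton.1
    (Finset.orderEmbOfFin_mem {i} (Finset.card_singleton i) 0)
  rw [formBasis, ExteriorAlgebra.basis_apply_ofCard _ (Finset.card_singleton i),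
    ExteriorAlgebra.ιMulti_family, ExteriorAlgebra.ιMulti_apply]
  simp only [List.ofFn_succ, List.ofFn_zero, List.prod_singleton, Function.comp_apply,
    Set.powersetCard.ofFinEmbEquiv_symm_apply]
  rw [Pi.basisFun_apply]
  congr 2
  exact h0.symm

theorem one_eq_formBasis : (1 : FormAlgebra F n) = formBasis F n ∅ := by
  rw [formBasis, ExteriorAlgebra.basis_apply_ofCard _ Finset.card_empty,
    ExteriorAlgebra.ιMulti_family, ExteriorAlgebra.ιMulti_apply, List.ofFn_zero, List.prod_nil]

theorem formBasis_mul (s t : Finset (Fin n)) : ∃ u, formBasis F n s * formBasis F n t = 0 ∨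
    formBasis F n s * formBasis F n t = formBasis F n u ∨
    formBasis F n s * formBasis F n t = - formBasis F n u := by
  by_cases h : Disjoint s t
  · have h1 := ExteriorAlgebra.basis_mul_of_disjoint (R := PolyRing F n)
      (Pi.basisFun (PolyRing F n) (Fin n)) (Set.powersetCard.ofCard (s := s) rfl) (Set.powersetCard.ofCard (s := t) rfl) h
    refine ⟨s.disjUnion t h, Or.inr ?_⟩
    rcases Int.units_eq_one_or ((Set.powersetCard.permOfDisjoint (s := Set.powersetCard.ofCard (s := s) rfl) (t := Set.powersetCard.ofCard (s := t) rfl) h).sign) with h2 | h2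
    · rw [h2, one_smul] at h1
      exact Or.inl h1
    · rw [h2, Units.neg_smul, one_smul] at h1
      exact Or.inr h1
  · exact ⟨∅, Or.inl (ExteriorAlgebra.basis_mul_of_not_disjoint (R := PolyRing F n)
      (Pi.basisFun (PolyRing F n) (Fin n)) (Set.powersetCard.ofCard (s := s) rfl) (Set.powersetCard.ofCard (s := t) rfl) h)⟩

theorem prod_ι_single_eq_formBasis (l : List (Fin n)) : ∃ u,
    (l.map fun i => ExteriorAlgebra.ι (PolyRing F n) (Pi.single i (1 : PolyRing F n))).prod = 0 ∨
    (l.map fun i => ExteriorAlgebra.ι (PolyRing F n) (Pi.single i (1 : PolyRing F n))).prod = formBasis F n u ∨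
    (l.map fun i => ExteriorAlgebra.ι (PolyRing F n) (Pi.single i (1 : PolyRing F n))).prod = - formBasis F n u := by
  induction l with
  | nil => exact ⟨∅, Or.inr (Or.inl one_eq_formBasis)⟩
  | cons i l ih =>
    obtain ⟨u, hu⟩ := ih
    obtain ⟨w, hw⟩ := formBasis_mul (F := F) {i} u
    refine ⟨w, ?_⟩
    rw [List.map_cons, List.prod_cons, ι_single_eq_formBasis]
    rcases hu with hu | hu | hu
    · exact Or.inl (by rw [hu, mul_zero])
    · rwa [hu]
    · rw [hu, mul_neg, neg_eq_zero, neg_inj, neg_eq_iff_eq_neg]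
      tauto

theorem formComponent_wedgeMonomial (m k : ℕ) (s : Fin k → Fin n) (c : PolyRing F n) :
    formComponent m (wedgeMonomial k s c) = wedgeMonomial k s (homogeneousComponent m c) := by
  have h1 : (List.ofFn fun i => ExteriorAlgebra.ι (PolyRing F n)
      (Pi.single (s i) (1 : PolyRing F n))) = (List.ofFn s).map fun i =>
        ExteriorAlgebra.ι (PolyRing F n) (Pi.single i (1 : PolyRing F n)) := by
    rw [List.map_ofFn]; rfl
  obtain ⟨u, hu⟩ := prod_ι_single_eq_formBasis (F := F) (List.ofFn s)
  rw [← h1] at hu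
  unfold wedgeMonomial
  rcases hu with hu | hu | hu
  · rw [hu, smul_zero, smul_zero, map_zero]
  · rw [hu, formComponent_smul_formBasis]
  · rw [hu, smul_neg, smul_neg, map_neg, formComponent_smul_formBasis]

theorem ι_mul_wedgeMonomial (v : Fin n → PolyRing F n) (k : ℕ) (s : Fin k → Fin n)
    (c : PolyRing F n) : ExteriorAlgebra.ι _ v * wedgeMonomial k s c =
      ∑ i, wedgeMonomial (k + 1) (Fin.cons i s) (v i * c) := by
  have hv : v = ∑ i, v i • Pi.single i (1 : PolyRing F n) := by
    simpa using (Pi.basisFun (PolyRing F n) (Fin n)).sum_repr v |>.symm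
  conv_lhs => rw [hv]
  rw [map_sum, Finset.sum_mul]
  refine Finset.sum_congr rfl fun i _ => ?_
  simp only [wedgeMonomial, List.ofFn_succ, Fin.cons_zero, Fin.cons_succ, List.prod_cons]
  rw [map_smul, smul_mul_smul_comm]

theorem IsHomogeneousForm.formComponent_eq {k m : ℕ} {ω : FormAlgebra F n}
    (h : IsHomogeneousForm k m ω) : formComponent m ω = ω :=
  (formComponent m).eqOn_closure (g := AddMonoidHom.id _) (by
    rintro _ ⟨s, c, hc, rfl⟩
    rw [ formComponent_wedgeMonomial, homogeneousComponent_of_mem hc, if_pos rfl]; rfl) h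

theorem IsForm.isHomogeneousForm_formComponent {k : ℕ} {ω : FormAlgebra F n} (h : IsForm k ω)
    (m : ℕ) : IsHomogeneousForm k m (formComponent m ω) := by
  refine (AddSubgroup.closure_le (K := (AddSubgroup.closure _).comap (formComponent m))).2 ?_ h
  rintro _ ⟨s, c, rfl⟩
  exact AddSubgroup.subset_closure ⟨s, _, homogeneousComponent_isHomogeneous m c,
    formComponent_wedgeMonomial m k s c⟩

theorem IsForm.formComponent_ι_mul {k : ℕ} {ω : FormAlgebra F n} (h : IsForm k ω)
    {v : Fin n → PolyRing F n} {e : ℕ} (hv : ∀ i, (v i).IsHomogeneous e) (m : ℕ) :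
    formComponent m (ExteriorAlgebra.ι _ v * ω) =
      if e ≤ m then ExteriorAlgebra.ι _ v * formComponent (m - e) ω else 0 := by
  have key := ((formComponent m).comp (AddMonoidHom.mulLeft (ExteriorAlgebra.ι _ v))).eqOn_closure
    (g := if e ≤ m then (AddMonoidHom.mulLeft (ExteriorAlgebra.ι _ v)).comp (formComponent (m - e))
      else 0) (by
    rintro _ ⟨s, c, rfl⟩
    have h1 : formComponent m (ExteriorAlgebra.ι _ v * wedgeMonomial k s c) = ∑ i,
        wedgeMonomial (k + 1) (Fin.cons i s) (homogeneousComponent m (v i * c)) := by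
      rw [ι_mul_wedgeMonomial, map_sum]
      exact Finset.sum_congr rfl fun i _ => formComponent_wedgeMonomial _ _ _ _
    refine h1.trans ?_
    simp only [(hv _).homogeneousComponent_mul]
    split_ifs
    · rw [AddMonoidHom.comp_apply, formComponent_wedgeMonomial]
      exact (ι_mul_wedgeMonomial _ _ _ _).symm
    · simp [wedgeMonomial]) h
  refine key.trans ?_
  split_ifs <;> rfl

theorem IsForm.exists_isHomogeneousForm {k : ℕ} {ω : FormAlgebra F n} (h : IsForm k ω)
    {v : Fin n → PolyRing F n} {e : ℕ} (hv : ∀ i, (v i).IsHomogeneous e) (m : ℕ) :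
    ∃ d η, IsHomogeneousForm k d η ∧
      formComponent m (ExteriorAlgebra.ι _ v * ω) = ExteriorAlgebra.ι _ v * η ∧
      ∀ (w : Fin n → PolyRing F n) (e' : ℕ), (∀ i, (w i).IsHomogeneous e') →
        ExteriorAlgebra.ι _ w * ω = 0 → ExteriorAlgebra.ι _ w * η = 0 := by
  by_cases hm : e ≤ m
  · refine ⟨m - e, _, h.isHomogeneousForm_formComponent _, (h.formComponent_ι_mul hv m).trans
      (if_pos hm), fun w e' hw h0 => ?_⟩
    have h1 := h.formComponent_ι_mul hw (m - e + e')
    rw [if_pos (Nat.le_add_left _ _), h0, map_zero, Nat.add_sub_cancel] at h1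
    exact h1.symm
  · exact ⟨0, 0, AddSubgroup.zero_mem _, by rw [h.formComponent_ι_mul hv, if_neg hm, mul_zero],
      fun _ _ _ _ => mul_zero _⟩

theorem isForm_of_mem_exteriorPower {k : ℕ} {ω : FormAlgebra F n}
    (h : ω ∈ ⋀[PolyRing F n]^k (Fin n → PolyRing F n)) : IsForm k ω := by
  induction k generalizing ω with
  | zero =>
    rw [ExteriorAlgebra.exteriorPower, pow_zero] at h
    obtain ⟨c, rfl⟩ := Submodule.mem_one.1 h
    exact AddSubgroup.subset_closure ⟨Fin.elim0, c, by
      simp [wedgeMonomial, Algebra.algebraMap_eq_smul_one]⟩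
  | succ k ih =>
    rw [ExteriorAlgebra.exteriorPower, pow_succ'] at h
    refine Submodule.mul_induction_on h ?_ fun _ _ => AddSubgroup.add_mem _
    rintro _ ⟨v, rfl⟩ u hu
    refine (AddSubgroup.closure_le (K := (AddSubgroup.closure _).comap
      (AddMonoidHom.mulLeft (ExteriorAlgebra.ι _ v)))).2 ?_ (ih hu)
    rintro _ ⟨s, c, rfl⟩
    refine (AddSubgroup.mem_comap).2 ?_
    rw [AddMonoidHom.coe_mulLeft, ι_mul_wedgeMonomial]
    exact AddSubgroup.sum_mem _ fun i _ => AddSubgroup.subset_closure ⟨_, _, rfl⟩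

theorem IsHomogeneousForm.mem_exteriorPower {k d : ℕ} {ω : FormAlgebra F n}
    (h : IsHomogeneousForm k d ω) : ω ∈ ⋀[PolyRing F n]^k (Fin n → PolyRing F n) := by
  refine (AddSubgroup.closure_le (K := (⋀[PolyRing F n]^k
    (Fin n → PolyRing F n)).toAddSubgroup)).2 ?_ h
  rintro _ ⟨s, c, -, rfl⟩
  refine Submodule.smul_mem _ _ ?_
  rw [← ExteriorAlgebra.ιMulti_apply]
  exact ExteriorAlgebra.ιMulti_range _ _ ⟨_, rfl⟩

end FormComponent

section Hypotheses

theorem IsSmoothCI.eq_zero {F : Type} [Field F] {n : ℕ} {ι : Type} [Fintype ι]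
    {g : ι → PolyRing F n} (hg : IsSmoothCI g) {x : Fin n → AlgebraicClosure F} (hx : x ≠ 0)
    (h0 : ∀ i, aeval x (g i) = 0) {c : ι → AlgebraicClosure F}
    (hc : ∀ l, ∑ i, c i * aeval x (pderiv l (g i)) = 0) : c = 0 := by
  have hev : ∀ q : PolyRing F n, eval x (map (algebraMap F (AlgebraicClosure F)) q) = aeval x q :=
    fun q => by rw [eval_map, aeval_def]
  have hli := not_imp_comm.1 (hg x fun i => (hev _).trans (h0 i)) hx
  refine funext (Fintype.linearIndependent_iff.1 hli c (funext fun l => ?_))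
  simpa [Finset.sum_apply, hev] using hc l

theorem smoothFactorization {F : Type} [Field F] {p n : ℕ} [CharP F p]
    (f : MvPolynomial (Fin n) F) {δ δ' : ℕ} (hdeg : f.totalDegree = δ) (hδ'1 : 1 ≤ δ')
    (hδ'2 : δ' ≤ δ - 1) {r : ℕ} (g : Fin r → MvPolynomial (Fin n) F) (a dg : Fin r → ℕ)
    (hgh : ∀ i, (g i).IsHomogeneous (dg i)) (ha : ∀ i, 0 < a i)
    (hfact : homogeneousComponent δ f = ∏ i, g i ^ a i)
    (hCI1 : ∀ s : Finset (Fin r), s.Nonempty → IsSmoothCI (fun i : s => g i))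
    (hCI2 : ∀ s : Finset (Fin r), (2 ≤ s.card ∨ ∃ i ∈ s, s.card = 1 ∧ 1 < a i) →
      IsSmoothCI (fun i : Option s =>
        i.elim (homogeneousComponent δ' f) (fun j => g j)))
    (hpdiv : ¬ (p ∣ δ * δ' * ∏ i, a i)) :
    SmoothFactorization (AlgebraicClosure F) g a dg (homogeneousComponent δ f)
      (homogeneousComponent δ' f) δ δ' where
  isHomogeneous := hgh
  isHomogeneous_left := homogeneousComponent_isHomogeneous _ _
  isHomogeneous_right := homogeneousComponent_isHomogeneous _ _
  pos := ha
  eq_prod := hfact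
  ne_zero h0 := by
    have hf : f ≠ 0 := by
      rintro rfl
      rw [totalDegree_zero] at hdeg
      omega
    obtain ⟨m, hm, hmd⟩ := Finset.exists_mem_eq_sup f.support (support_nonempty.2 hf)
      fun m => m.degree
    have h1 := congrArg (coeff m) h0
    rw [coeff_homogeneousComponent, if_pos, coeff_zero] at h1
    · exact mem_support_iff.1 hm h1
    · exact hmd.symm.trans hdeg
  cast_left_ne_zero h0 := hpdiv (((CharP.cast_eq_zero_iff F p _).1 h0).mul_right _ |>.mul_right _)
  cast_right_ne_zero h0 := hpdiv (((CharP.cast_eq_zero_iff F p _).1 h0).mul_left _ |>.mul_right _)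
  cast_ne_zero i h0 := hpdiv ((((CharP.cast_eq_zero_iff F p _).1 h0).trans
    (Finset.dvd_prod_of_mem a (Finset.mem_univ i))).mul_left _)
  independent x hx s hs h0 c hc hsum := by
    have h1 := (hCI1 s hs).eq_zero hx (fun i => h0 i i.2) (c := fun i => c i) fun l => by
      rw [← hsum l, Finset.sum_coe_sort s fun i => c i * aeval x (pderiv l (g i))]
      exact Finset.sum_subset (Finset.subset_univ s) fun i _ hi => by rw [hc i hi, zero_mul]
    ext i
    by_cases hi : i ∈ s
    · exact congrFun h1 ⟨i, hi⟩
    · exact hc i hi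
  independent_insert x hx s hs h0 hG b c hc hsum := by
    refine congrFun ((hCI2 s hs).eq_zero hx (c := fun o => o.elim b fun i => c i)
      (fun o => ?_) fun l => ?_) none
    · cases o with
      | none => exact hG
      | some i => exact h0 i i.2
    · rw [Fintype.sum_option, ← hsum l]
      refine congrArg _ ((Finset.sum_coe_sort s fun i => c i * aeval x (pderiv l (g i))).trans ?_)
      exact Finset.sum_subset (Finset.subset_univ s) fun i _ hi => by rw [hc i hi, zero_mul]

end Hypotheses

/-- Proposition 5.1: under the hypotheses of Theorem 1.18, if ω is a homogeneous
k-form (k < n) with df^{(δ)} ∧ ω = 0 and df^{(δ')} ∧ ω = df^{(δ)} ∧ ξ for some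
homogeneous form ξ, then ω = df^{(δ')} ∧ η₁ + df^{(δ)} ∧ η₂ with η₁, η₂ homogeneous
(k-1)-forms and df^{(δ)} ∧ η₁ = 0. -/
theorem proposition_5_1 {F : Type} [Field F] [Fintype F] {p n : ℕ} [CharP F p] (hp : p.Prime)
    (f : MvPolynomial (Fin n) F) (δ δ' : ℕ)
    (hdeg : f.totalDegree = δ) (hδ'1 : 1 ≤ δ') (hδ'2 : δ' ≤ δ - 1)
    (hmid : ∀ j, δ' < j → j < δ → MvPolynomial.homogeneousComponent j f = 0)
    {r : ℕ} (g : Fin r → MvPolynomial (Fin n) F) (a : Fin r → ℕ) (dg : Fin r → ℕ)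
    (hgh : ∀ i, (g i).IsHomogeneous (dg i)) (ha : ∀ i, 0 < a i)
    (hfact : MvPolynomial.homogeneousComponent δ f = ∏ i, g i ^ a i)
    (hCI1 : ∀ s : Finset (Fin r), s.Nonempty → IsSmoothCI (fun i : s => g i))
    (hCI2 : ∀ s : Finset (Fin r), (2 ≤ s.card ∨ ∃ i ∈ s, s.card = 1 ∧ 1 < a i) →
      IsSmoothCI (fun i : Option s =>
        i.elim (MvPolynomial.homogeneousComponent δ' f) (fun j => g j)))
    (hpdiv : ¬ (p ∣ δ * δ' * ∏ i, a i))
    (k : ℕ) (hk : k < n) (dω : ℕ) (ω : FormAlgebra F n)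
    (hω : IsHomogeneousForm k dω ω)
    (hZ : dform (MvPolynomial.homogeneousComponent δ f) * ω = 0)
    (hξ : ∃ (dξ : ℕ) (ξ : FormAlgebra F n), IsHomogeneousForm k dξ ξ ∧
      dform (MvPolynomial.homogeneousComponent δ' f) * ω =
        dform (MvPolynomial.homogeneousComponent δ f) * ξ) :
    ∃ (d₁ d₂ : ℕ) (η₁ η₂ : FormAlgebra F n),
      IsHomogeneousForm (k - 1) d₁ η₁ ∧ IsHomogeneousForm (k - 1) d₂ η₂ ∧
      dform (MvPolynomial.homogeneousComponent δ f) * η₁ = 0 ∧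
      ω = dform (MvPolynomial.homogeneousComponent δ' f) * η₁ +
          dform (MvPolynomial.homogeneousComponent δ f) * η₂ := by
  have h := smoothFactorization (p := p) f hdeg hδ'1 hδ'2 g a dg hgh ha hfact hCI1 hCI2 hpdiv
  obtain ⟨_, ξ, hξ, hξω⟩ := hξ
  have hmem := h.mem_wedgeSum hk (mem_wedgeKer.2 ⟨hω.mem_exteriorPower, hZ⟩)
    ⟨ξ, hξ.mem_exteriorPower, hξω.symm⟩
  cases k with
  | zero =>
    refine ⟨0, 0, 0, 0, AddSubgroup.zero_mem _, AddSubgroup.zero_mem _, mul_zero _, ?_⟩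
    rw [(Submodule.mem_bot _).1 hmem, mul_zero, mul_zero, add_zero]
  | succ j =>
    obtain ⟨_, ⟨y, hy, rfl⟩, _, ⟨x, hx, rfl⟩, hxy⟩ := Submodule.mem_sup.1 hmem
    obtain ⟨hx, hx0⟩ := mem_wedgeKer.1 hx
    obtain ⟨d₁, η₁, h1, hx1, hker⟩ := (isForm_of_mem_exteriorPower hx).exists_isHomogeneousForm
      (fun _ => h.isHomogeneous_right.pderiv) dω
    obtain ⟨d₂, η₂, h2, hy2, -⟩ := (isForm_of_mem_exteriorPower hy).exists_isHomogeneousForm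
      (fun _ => h.isHomogeneous_left.pderiv) dω
    refine ⟨d₁, d₂, η₁, η₂, h1, h2, hker _ _ (fun _ => h.isHomogeneous_left.pderiv) hx0, ?_⟩
    rw [← hω.formComponent_eq, ← hxy, map_add, add_comm]
    exact congrArg₂ _ hx1 hy2
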